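/- arXiv:0906.2183 — 3 statements merged into one kernel-verified Lean document; each statement's English description precedes it below -/
import Mathlib

section
/- Let r ≥ 1 and let n_1,…,n_r and m_1,…,m_r be positive integers with common sum n = n_1+⋯+n_r = m_1+⋯+m_r, and set k = ⌈n/r⌉. Then φ(1^{n_1}0^{m_1}⋯1^{n_r}0^{m_r}) ≤ φ((1^k 0^k)^r), where (1^k 0^k)^r denotes the r-fold concatenation of the word 1^k 0^k. -/
/-- A pairing of the positions `Fin N`: a collection of blocks, each of size 2,
with every position in exactly one block. -/
def IsPairing {N : ℕ} (π : Finset (Finset (Fin N))) : Prop :=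
  (∀ B ∈ π, B.card = 2) ∧ ∀ i : Fin N, ∃! B, B ∈ π ∧ i ∈ B

/-- A crossing: blocks `{i₁,i₂}` and `{j₁,j₂}` with `i₁ < j₁ < i₂ < j₂`. -/
def HasCrossing {N : ℕ} (π : Finset (Finset (Fin N))) : Prop :=
  ∃ B ∈ π, ∃ C ∈ π, ∃ i₁ i₂ j₁ j₂ : Fin N,
    i₁ ∈ B ∧ i₂ ∈ B ∧ j₁ ∈ C ∧ j₂ ∈ C ∧ i₁ < j₁ ∧ j₁ < i₂ ∧ i₂ < j₂

/-- A non-crossing `w`-pairing: a non-crossing pairing of the positions of the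
bitstring `w` (ones are `true`, zeros are `false`) pairing unequal letters. -/
def IsNCPairingOn (w : List Bool) (π : Finset (Finset (Fin w.length))) : Prop :=
  IsPairing π ∧ ¬ HasCrossing π ∧
    ∀ B ∈ π, ∀ i ∈ B, ∀ j ∈ B, i ≠ j → w.get i ≠ w.get j

/-- `phi w` is the number of non-crossing `w`-pairings. -/
noncomputable def phi (w : List Bool) : ℕ :=
  Set.ncard {π : Finset (Finset (Fin w.length)) | IsNCPairingOn w π}

/-- The word `1^{n 0} 0^{m 0} 1^{n 1} 0^{m 1} ⋯ 1^{n (r-1)} 0^{m (r-1)}`. -/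
def runsF {r : ℕ} (n m : Fin r → ℕ) : List Bool :=
  (List.finRange r).flatMap fun i => List.replicate (n i) true ++ List.replicate (m i) false

/-- The word `1^{k₁} 0^{k₁} ⋯ 1^{k_r} 0^{k_r}` for `l = [k₁, …, k_r]`. -/
def symWord (l : List ℕ) : List Bool :=
  l.flatMap fun k => List.replicate k true ++ List.replicate k false

/-- The symmetrized pairing function `φ*(n₁,…,n_r) = φ(1^{n₁}0^{n₁}⋯1^{n_r}0^{n_r})`. -/
noncomputable def phiStar (l : List ℕ) : ℕ := phi (symWord l)

/-- `Yval w i` is the lattice-path value `Y_i`. -/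
def Yval (w : List Bool) (i : ℕ) : ℤ :=
  ((w.take i).count true : ℤ) - ((w.take i).count false : ℤ)

/-- The height of position `i` of `w`, relative to the minimum `mY` of the `Y_i`. -/
def heightAt (w : List Bool) (mY : ℤ) (i : Fin w.length) : ℤ :=
  if w.get i then Yval w (i.val + 1) - mY else Yval w (i.val + 1) - mY + 1

/-- `d : Fin r → ℕ` is a Catalan degree sequence of order `r`. -/
def IsCatalanSeq (r : ℕ) (d : Fin r → ℕ) : Prop :=
  (∀ i : ℕ, 1 ≤ i → i ≤ r - 1 →
      (i : ℕ) ≤ ∑ j ∈ Finset.univ.filter (fun j : Fin r => (j : ℕ) < i), d j) ∧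
  ∑ j, d j = r - 1

/-- Sum of the first `j` values of `f`. -/
def prefSum {r : ℕ} (f : Fin r → ℕ) (j : ℕ) : ℕ :=
  ∑ i ∈ Finset.univ.filter (fun i : Fin r => (i : ℕ) < j), f i

/-- `m` is a member of `CF(n)`. -/
def InCF {r : ℕ} (n m : Fin r → ℕ) : Prop :=
  (∀ j : ℕ, 1 ≤ j → j ≤ r - 1 → prefSum m j ≤ prefSum n j) ∧
  (∑ i, m i = ∑ i, n i)

/-- The number of ways in which reading `w` empties a stack that starts as `s`, where each letter
is either pushed or cancels an unequal letter on top of the stack. -/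
def stackCount : List Bool → List Bool → ℕ
  | [], s => if s = [] then 1 else 0
  | x :: w, [] => stackCount w [x]
  | x :: w, y :: s => stackCount w (x :: y :: s) + if y ≠ x then stackCount w s else 0

/-- A non-crossing matching of the positions in `s` together with all positions `≥ p` of `w`, in
which no two positions of `s` are matched. -/
def IsPartialPairing (w : List Bool) (p : ℕ) (s : List (Fin w.length))
    (π : Finset (Finset (Fin w.length))) : Prop :=
  (∀ B ∈ π, B.card = 2) ∧ (∀ i : Fin w.length, i ∈ s ∨ p ≤ (i : ℕ) → ∃! B, B ∈ π ∧ i ∈ B) ∧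
    (∀ B ∈ π, ∀ i ∈ B, i ∈ s ∨ p ≤ (i : ℕ)) ∧ ¬ HasCrossing π ∧
    (∀ B ∈ π, ∀ i ∈ B, ∀ j ∈ B, i ≠ j → w.get i ≠ w.get j) ∧
    ∀ B ∈ π, ∀ i ∈ B, ∀ j ∈ B, i ∈ s → j ∈ s → i = j

theorem isPartialPairing_push {w : List Bool} {p : ℕ} (hp : p < w.length)
    {s : List (Fin w.length)} {π : Finset (Finset (Fin w.length))}
    (h : IsPartialPairing w (p + 1) (⟨p, hp⟩ :: s) π) : IsPartialPairing w p s π := by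
  obtain ⟨h1, h2, h3, h4, h5, h6⟩ := h
  refine ⟨h1, fun i hi => h2 i ?_, fun B hB i hi => ?_, h4, h5, fun B hB i hi j hj his hjs => ?_⟩
  · rcases hi with hi | hi
    · simp [hi]
    · rcases Nat.eq_or_lt_of_le hi with h | h
      · left; simp [h]
      · right; omega
  · rcases h3 B hB i hi with h | h
    · rcases List.mem_cons.1 h with h | h
      · right; simp [h]
      · left; exact h
    · right; omega
  · exact h6 B hB i hi j hj (List.mem_cons_of_mem _ his) (List.mem_cons_of_mem _ hjs)

theorem isPartialPairing_of_push {w : List Bool} {p : ℕ} (hp : p < w.length)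
    {s : List (Fin w.length)} {π : Finset (Finset (Fin w.length))}
    (h : IsPartialPairing w p s π)
    (hs : ∀ B ∈ π, ∀ i ∈ B, i ∈ s → ⟨p, hp⟩ ∉ B) :
    IsPartialPairing w (p + 1) (⟨p, hp⟩ :: s) π := by
  obtain ⟨h1, h2, h3, h4, h5, h6⟩ := h
  refine ⟨h1, fun i hi => h2 i ?_, fun B hB i hi => ?_, h4, h5, fun B hB i hi j hj his hjs => ?_⟩
  · rcases hi with hi | hi
    · rcases List.mem_cons.1 hi with h | h
      · right; simp [h]
      · left; exact h
    · right; omega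
  · rcases h3 B hB i hi with h | h
    · simp [h]
    · rcases Nat.eq_or_lt_of_le h with h | h
      · left; simp [h]
      · right; omega
  · rcases List.mem_cons.1 his with rfl | his <;> rcases List.mem_cons.1 hjs with rfl | hjs
    · rfl
    · exact absurd hi (hs B hB j hj hjs)
    · exact absurd hj (hs B hB i hi his)
    · exact h6 B hB i hi j hj his hjs

theorem isPartialPairing_insert {w : List Bool} {p : ℕ} (hp : p < w.length) {t : Fin w.length}
    {s : List (Fin w.length)} (hs : (t :: s).Pairwise (· > ·)) (ht : (t : ℕ) < p)
    (hw : w.get t ≠ w.get ⟨p, hp⟩) {π : Finset (Finset (Fin w.length))}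
    (h : IsPartialPairing w (p + 1) s π) :
    IsPartialPairing w p (t :: s) (insert {t, ⟨p, hp⟩} π) := by
  obtain ⟨h1, h2, h3, h4, h5, h6⟩ := h
  have hts : ∀ i ∈ s, (i : ℕ) < t := fun i hi => (List.pairwise_cons.1 hs).1 i hi
  have hout : ∀ B ∈ π, ∀ i ∈ B, (i : ℕ) < t ∨ p < (i : ℕ) := fun B hB i hi =>
    (h3 B hB i hi).imp (hts i) id
  have htp : t ≠ ⟨p, hp⟩ := fun h => by simp [h] at ht
  refine ⟨?_, ?_, ?_, ?_, ?_, ?_⟩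
  · intro B hB
    rcases Finset.mem_insert.1 hB with rfl | hB
    · exact Finset.card_pair htp
    · exact h1 B hB
  · intro i hi
    by_cases hi2 : i = t ∨ i = ⟨p, hp⟩
    · refine ⟨{t, ⟨p, hp⟩}, by simp [hi2], ?_⟩
      rintro B ⟨hB, hiB⟩
      rcases Finset.mem_insert.1 hB with rfl | hB
      · rfl
      · have := hout B hB i hiB
        rcases hi2 with rfl | rfl <;> simp at this <;> omega
    · push Not at hi2
      have : i ∈ s ∨ p + 1 ≤ (i : ℕ) := by
        rcases hi with hi | hi
        · simp [hi2.1] at hi; exact Or.inl hi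
        · have := hi2.2; rw [Ne, Fin.ext_iff] at this; simp at this; right; omega
      obtain ⟨B, ⟨hB, hiB⟩, hu⟩ := h2 i this
      refine ⟨B, ⟨Finset.mem_insert_of_mem hB, hiB⟩, ?_⟩
      rintro C ⟨hC, hiC⟩
      rcases Finset.mem_insert.1 hC with rfl | hC
      · simp [hi2] at hiC
      · exact hu C ⟨hC, hiC⟩
  · intro B hB i hi
    rcases Finset.mem_insert.1 hB with rfl | hB
    · simp only [Finset.mem_insert, Finset.mem_singleton] at hi
      rcases hi with rfl | rfl <;> simp
    · rcases h3 B hB i hi with h | h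
      · simp [h]
      · right; omega
  · rintro ⟨B, hB, C, hC, i₁, i₂, j₁, j₂, hi₁, hi₂, hj₁, hj₂, hlt₁, hlt₂, hlt₃⟩
    rw [Fin.lt_def] at hlt₁ hlt₂ hlt₃
    rcases Finset.mem_insert.1 hB with rfl | hB <;> rcases Finset.mem_insert.1 hC with rfl | hC
    · simp only [Finset.mem_insert, Finset.mem_singleton, Fin.ext_iff] at *; omega
    · have := hout C hC j₁ hj₁; have := hout C hC j₂ hj₂
      simp only [Finset.mem_insert, Finset.mem_singleton, Fin.ext_iff] at hi₁ hi₂; omega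
    · have := hout B hB i₁ hi₁; have := hout B hB i₂ hi₂
      simp only [Finset.mem_insert, Finset.mem_singleton, Fin.ext_iff] at hj₁ hj₂; omega
    · exact h4 ⟨B, hB, C, hC, i₁, i₂, j₁, j₂, hi₁, hi₂, hj₁, hj₂, hlt₁, hlt₂, hlt₃⟩
  · intro B hB i hi j hj hij
    rcases Finset.mem_insert.1 hB with rfl | hB
    · simp only [Finset.mem_insert, Finset.mem_singleton] at hi hj
      rcases hi with rfl | rfl <;> rcases hj with rfl | rfl
      · exact absurd rfl hij
      · exact hw
      · exact hw.symm
      · exact absurd rfl hij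
    · exact h5 B hB i hi j hj hij
  · intro B hB i hi j hj his hjs
    have hne : ∀ i ∈ t :: s, (i : ℕ) < p := fun i hi => by
      rcases List.mem_cons.1 hi with rfl | hi
      · exact ht
      · exact (hts i hi).trans ht
    have := hne i his; have := hne j hjs
    rcases Finset.mem_insert.1 hB with rfl | hB
    · simp only [Finset.mem_insert, Finset.mem_singleton, Fin.ext_iff] at hi hj
      ext; omega
    · have := hout B hB i hi; have := hout B hB j hj
      refine h6 B hB i hi j hj ?_ ?_
      · rcases h3 B hB i hi with h | h
        · exact h
        · omega
      · rcases h3 B hB j hj with h | h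
        · exact h
        · omega

theorem isPartialPairing_erase {w : List Bool} {p : ℕ} (hp : p < w.length) {t : Fin w.length}
    {s : List (Fin w.length)} (hs : (t :: s).Pairwise (· > ·)) (ht : (t : ℕ) < p)
    {π : Finset (Finset (Fin w.length))}
    (h : IsPartialPairing w p (t :: s) π) (hB : {t, ⟨p, hp⟩} ∈ π) :
    IsPartialPairing w (p + 1) s (π.erase {t, ⟨p, hp⟩}) := by
  obtain ⟨h1, h2, h3, h4, h5, h6⟩ := h
  have hts : ∀ i ∈ s, (i : ℕ) < t := fun i hi => (List.pairwise_cons.1 hs).1 i hi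
  refine ⟨fun B hB => h1 B (Finset.mem_of_mem_erase hB), ?_, ?_, ?_,
    fun B hB => h5 B (Finset.mem_of_mem_erase hB), fun B hB i hi j hj his hjs =>
      h6 B (Finset.mem_of_mem_erase hB) i hi j hj (List.mem_cons_of_mem _ his)
        (List.mem_cons_of_mem _ hjs)⟩
  · intro i hi
    have hi' : i ∈ t :: s ∨ p ≤ (i : ℕ) := by
      rcases hi with hi | hi
      · simp [hi]
      · right; omega
    have hni : i ∉ ({t, ⟨p, hp⟩} : Finset (Fin w.length)) := by
      simp only [Finset.mem_insert, Finset.mem_singleton, Fin.ext_iff]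
      rcases hi with hi | hi
      · have := hts i hi; omega
      · omega
    obtain ⟨B, ⟨hB, hiB⟩, hu⟩ := h2 i hi'
    refine ⟨B, ⟨Finset.mem_erase.2 ⟨fun h => hni (h ▸ hiB), hB⟩, hiB⟩, ?_⟩
    rintro C ⟨hC, hiC⟩
    exact hu C ⟨Finset.mem_of_mem_erase hC, hiC⟩
  · intro B' hB' i hi
    obtain ⟨hne, hmem⟩ := Finset.mem_erase.1 hB'
    have hni : i ≠ t ∧ i ≠ ⟨p, hp⟩ := by
      constructor <;> rintro rfl
      · obtain ⟨C, _, hu⟩ := h2 i (by simp)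
        exact hne ((hu B' ⟨hmem, hi⟩).trans (hu _ ⟨hB, by simp⟩).symm)
      · obtain ⟨C, _, hu⟩ := h2 ⟨p, hp⟩ (by simp)
        exact hne ((hu B' ⟨hmem, hi⟩).trans (hu _ ⟨hB, by simp⟩).symm)
    rcases h3 B' hmem i hi with h | h
    · simp [hni.1] at h; exact Or.inl h
    · have := hni.2; rw [Ne, Fin.ext_iff] at this; simp at this; right; omega
  · rintro ⟨B, hB, C, hC, h⟩
    exact h4 ⟨B, Finset.mem_of_mem_erase hB, C, Finset.mem_of_mem_erase hC, h⟩

theorem IsPartialPairing.top_mem {w : List Bool} {p : ℕ} (hp : p < w.length) {t : Fin w.length}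
    {s : List (Fin w.length)} (hs : (t :: s).Pairwise (· > ·)) (ht : (t : ℕ) < p)
    {π : Finset (Finset (Fin w.length))} (h : IsPartialPairing w p (t :: s) π)
    {B : Finset (Fin w.length)} (hB : B ∈ π) {i : Fin w.length} (hi : i ∈ B) (his : i ∈ t :: s)
    (hpB : ⟨p, hp⟩ ∈ B) : {t, ⟨p, hp⟩} ∈ π := by
  obtain ⟨h1, h2, h3, h4, h5, h6⟩ := h
  have hts : ∀ i ∈ s, (i : ℕ) < t := fun i hi => (List.pairwise_cons.1 hs).1 i hi
  have key : ∀ C ∈ π, ∀ a b : Fin w.length, a ∈ C → b ∈ C → a ≠ b → C = {a, b} := by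
    intro C hC a b ha hb hab
    symm
    apply Finset.eq_of_subset_of_card_le
    · intro x hx; simp at hx; rcases hx with rfl | rfl <;> assumption
    · rw [h1 C hC, Finset.card_pair hab]
  rcases List.mem_cons.1 his with rfl | his'
  · have := key B hB i ⟨p, hp⟩ hi hpB (fun h => by simp [h] at ht)
    exact this ▸ hB
  · exfalso
    have hit := hts i his'
    obtain ⟨C, ⟨hC, htC⟩, -⟩ := h2 t (by simp)
    obtain ⟨j, hj, hjt⟩ := Finset.exists_mem_ne (by rw [h1 C hC]; norm_num) t
    have hjs : j ∉ t :: s := fun hjs => hjt (h6 C hC j hj t htC hjs (by simp))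
    have hjp : p ≤ (j : ℕ) := (h3 C hC j hj).resolve_left hjs
    have hne : j ≠ ⟨p, hp⟩ := by
      rintro rfl
      obtain ⟨D, -, hu⟩ := h2 ⟨p, hp⟩ (by simp)
      have hCB : C = B := (hu C ⟨hC, hj⟩).trans (hu B ⟨hB, hpB⟩).symm
      subst hCB
      have := h6 C hC i hi t htC his (by simp)
      simp [this] at hit
    rw [Ne, Fin.ext_iff] at hne; simp at hne
    exact h4 ⟨B, hB, C, hC, i, ⟨p, hp⟩, t, j, hi, hpB, htC, hj, hit, ht, by
      rw [Fin.lt_def]; simp; omega⟩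

theorem ncard_isPartialPairing (w : List Bool) (d : ℕ) : ∀ (p : ℕ) (s : List (Fin w.length)),
    p + d = w.length → s.Pairwise (· > ·) → (∀ i ∈ s, (i : ℕ) < p) →
    {π | IsPartialPairing w p s π}.ncard = stackCount (w.drop p) (s.map w.get) := by
  induction d with
  | zero =>
    intro p s hpd hs hsp
    have hdrop : w.drop p = [] := by simp; omega
    rw [hdrop]
    rcases s with - | ⟨t, s⟩
    · have : {π | IsPartialPairing w p [] π} = {∅} := by
        ext π
        simp only [Set.mem_ofPred_eq, Set.mem_singleton_iff]
        constructor
        · rintro ⟨h1, h2, h3, -⟩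
          rw [Finset.eq_empty_iff_forall_notMem]
          intro B hB
          obtain ⟨i, hi⟩ := Finset.card_pos.1 (by rw [h1 B hB]; norm_num : 0 < B.card)
          rcases h3 B hB i hi with h | h
          · simp at h
          · have := i.2; omega
        · rintro rfl
          refine ⟨by simp, fun i hi => ?_, by simp, ?_, by simp, by simp⟩
          · rcases hi with h | h
            · simp at h
            · have := i.2; omega
          · rintro ⟨B, hB, -⟩; simp at hB
      simp [this, stackCount]
    · have : {π | IsPartialPairing w p (t :: s) π} = ∅ := by
        ext π
        simp only [Set.mem_ofPred_eq, Set.mem_empty_iff_false, iff_false]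
        rintro ⟨h1, h2, h3, -, -, h6⟩
        obtain ⟨B, ⟨hB, ht⟩, -⟩ := h2 t (by simp)
        obtain ⟨j, hj, hjt⟩ := Finset.exists_mem_ne (by rw [h1 B hB]; norm_num) t
        rcases h3 B hB j hj with h | h
        · exact hjt (h6 B hB j hj t ht h (by simp))
        · have := j.2; omega
      simp [this, stackCount]
  | succ d ih =>
    intro p s hpd hs hsp
    have hp : p < w.length := by omega
    have hdrop : w.drop p = w.get ⟨p, hp⟩ :: w.drop (p + 1) := by
      simp
    have hpush := ih (p + 1) (⟨p, hp⟩ :: s) (by omega)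
      (List.pairwise_cons.2 ⟨fun i hi => Fin.lt_def.2 (hsp i hi), hs⟩) (by
        intro i hi
        rcases List.mem_cons.1 hi with rfl | hi
        · simp
        · exact (hsp i hi).trans (Nat.lt_succ_self p))
    rw [hdrop]
    rcases s with - | ⟨t, s⟩
    · have : {π | IsPartialPairing w p [] π} =
          {π | IsPartialPairing w (p + 1) [⟨p, hp⟩] π} := by
        ext π
        exact ⟨fun h => isPartialPairing_of_push hp h (by simp), isPartialPairing_push hp⟩
      rw [this, hpush]
      simp only [List.map_cons, List.map_nil, stackCount]
    · have ht : (t : ℕ) < p := hsp t (by simp)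
      have hts : ∀ i ∈ s, (i : ℕ) < t := fun i hi => (List.pairwise_cons.1 hs).1 i hi
      have hpop := ih (p + 1) s (by omega) (List.pairwise_cons.1 hs).2 (fun i hi =>
        (hts i hi).trans (ht.trans (Nat.lt_succ_self p)))
      have hnot : ∀ π, IsPartialPairing w (p + 1) s π → {t, ⟨p, hp⟩} ∉ π := by
        rintro π ⟨-, -, h3, -⟩ hmem
        rcases h3 _ hmem t (by simp) with h | h
        · exact absurd (hts t h) (lt_irrefl _)
        · omega
      by_cases hw : w.get t = w.get ⟨p, hp⟩
      · have : {π | IsPartialPairing w p (t :: s) π} =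
            {π | IsPartialPairing w (p + 1) (⟨p, hp⟩ :: t :: s) π} := by
          ext π
          refine ⟨fun h => isPartialPairing_of_push hp h fun B hB i hi his hpB => ?_,
            isPartialPairing_push hp⟩
          exact h.2.2.2.2.1 _ (h.top_mem hp hs ht hB hi his hpB) t (by simp) ⟨p, hp⟩ (by simp)
            (fun h => by simp [h] at ht) hw
        rw [this, hpush]
        simp only [List.map_cons, stackCount, hw]
        simp
      · have : {π | IsPartialPairing w p (t :: s) π} =
            {π | IsPartialPairing w (p + 1) (⟨p, hp⟩ :: t :: s) π} ∪
              insert {t, ⟨p, hp⟩} '' {π | IsPartialPairing w (p + 1) s π} := by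
          ext π
          simp only [Set.mem_ofPred_eq, Set.mem_union, Set.mem_image]
          constructor
          · intro h
            by_cases hc : ∀ B ∈ π, ∀ i ∈ B, i ∈ t :: s → ⟨p, hp⟩ ∉ B
            · exact Or.inl (isPartialPairing_of_push hp h hc)
            · push Not at hc
              obtain ⟨B, hB, i, hi, his, hpB⟩ := hc
              have hmem := h.top_mem hp hs ht hB hi his hpB
              exact Or.inr ⟨_, isPartialPairing_erase hp hs ht h hmem,
                Finset.insert_erase hmem⟩
          · rintro (h | ⟨π', h, rfl⟩)
            · exact isPartialPairing_push hp h
            · exact isPartialPairing_insert hp hs ht hw h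
        rw [this, Set.ncard_union_eq _ (Set.toFinite _) (Set.toFinite _), hpush,
          Set.InjOn.ncard_image, hpop]
        · simp only [List.map_cons, stackCount, ne_eq, hw, not_false_eq_true, if_true]
        · intro π₁ h₁ π₂ h₂ he
          rw [← Finset.erase_insert (hnot π₁ h₁), ← Finset.erase_insert (hnot π₂ h₂)]
          exact congrArg (fun π => Finset.erase π _) he
        · rw [Set.disjoint_left]
          rintro _ h ⟨π', -, rfl⟩
          have := h.2.2.2.2.2 _ (Finset.mem_insert_self _ _) t (by simp) ⟨p, hp⟩ (by simp)
            (by simp) (by simp)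
          simp [this] at ht

theorem phi_eq_stackCount (w : List Bool) : phi w = stackCount w [] := by
  have := ncard_isPartialPairing w w.length 0 [] (by simp) List.Pairwise.nil (by simp)
  simp only [List.drop_zero, List.map_nil] at this
  rw [← this, phi]
  congr 1
  ext π
  simp [IsNCPairingOn, IsPartialPairing, IsPairing]
  tauto

/-- The function `s ↦ f t` on nonempty stacks `s = (!x) :: t`, extended by zero. -/
def popTop (x : Bool) (f : List Bool → ℕ) : List Bool → ℕ
  | [] => 0
  | y :: s => if y ≠ x then f s else 0

theorem stackCount_cons (x : Bool) (w s : List Bool) :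
    stackCount (x :: w) s = stackCount w (x :: s) + popTop x (stackCount w) s := by
  cases s <;> simp [stackCount, popTop]

theorem stackCount_map_not (w : List Bool) : ∀ s : List Bool,
    stackCount (w.map not) (s.map not) = stackCount w s := by
  induction w with
  | nil => intro s; simp [stackCount]
  | cons x w ih =>
    intro s
    rw [List.map_cons, stackCount_cons, stackCount_cons, ← List.map_cons, ih]
    cases s <;> simp [popTop, ih]

/-- Appending `x` to `w` either leaves a stack to be emptied that has `x` at its bottom, or
cancels the bottom of the stack. -/
theorem stackCount_append_singleton (x : Bool) (w : List Bool) : ∀ s : List Bool,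
    stackCount (w ++ [x]) s = stackCount w (s ++ [x]) +
      if s.getLast? = some (!x) then stackCount w s.dropLast else 0 := by
  induction w with
  | nil =>
    intro s
    rcases s with - | ⟨y, - | ⟨z, s⟩⟩
    · simp [stackCount]
    · cases x <;> cases y <;> simp [stackCount]
    · cases x <;> cases y <;> simp [stackCount]
  | cons y w ih =>
    intro s
    rw [List.cons_append, stackCount_cons, ih, stackCount_cons, stackCount_cons]
    rcases s with - | ⟨z, s⟩
    · cases x <;> cases y <;> simp [popTop]
    · rcases s with - | ⟨z', s⟩
      · simp only [popTop, List.cons_append, List.nil_append]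
        rw [ih]
        cases x <;> cases y <;> cases z <;> simp
      · simp only [popTop, List.cons_append, List.getLast?_cons_cons, List.dropLast_cons_cons]
        rw [ih]
        simp only [List.cons_append]
        split_ifs <;> ring

theorem stackCount_append_comm (u v : List Bool) :
    stackCount (u ++ v) [] = stackCount (v ++ u) [] := by
  induction u generalizing v with
  | nil => simp
  | cons x u ih =>
    have h := stackCount_append_singleton x (u ++ v) []
    rw [List.cons_append, stackCount_cons, popTop, add_zero, List.append_cons, ← ih,
      ← List.append_assoc, h]
    simp

open scoped ENNReal in
theorem tsum_stackCount_cons (x : Bool) (w v : List Bool) :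
    ∑' s, (stackCount (x :: w) s * stackCount v s : ℝ≥0∞) =
      ∑' s, (stackCount w s * stackCount ((!x) :: v) s : ℝ≥0∞) := by
  have key : ∀ (y : Bool) (f g : List Bool → ℕ),
      ∑' s, (popTop y f s * g s : ℝ≥0∞) = ∑' s, (f s * g ((!y) :: s) : ℝ≥0∞) := by
    intro y f g
    rw [← (List.cons_injective (a := !y)).tsum_eq]
    · refine tsum_congr fun s => ?_
      simp [popTop]
    · intro s hs
      rcases s with - | ⟨z, s⟩
      · simp [popTop] at hs
      · refine ⟨s, ?_⟩
        cases y <;> cases z <;> simp [popTop] at hs ⊢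
  simp only [stackCount_cons, Nat.cast_add, add_mul, mul_add, ENNReal.tsum_add]
  rw [key, add_comm]
  congr 1
  have := key (!x) (stackCount v) (stackCount w)
  rw [Bool.not_not] at this
  simp only [mul_comm] at this ⊢
  exact this.symm

open scoped ENNReal in
theorem tsum_stackCount_append (u w v : List Bool) :
    ∑' s, (stackCount (u ++ w) s * stackCount v s : ℝ≥0∞) =
      ∑' s, (stackCount w s * stackCount ((u.map not).reverse ++ v) s : ℝ≥0∞) := by
  induction u generalizing v with
  | nil => simp
  | cons x u ih => rw [List.cons_append, tsum_stackCount_cons, ih]; simp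

open scoped ENNReal in
theorem stackCount_reverse_append (u v : List Bool) :
    (stackCount ((u.map not).reverse ++ v) [] : ℝ≥0∞) =
      ∑' s, (stackCount u s * stackCount v s : ℝ≥0∞) := by
  have := tsum_stackCount_append u [] v
  rw [List.append_nil] at this
  rw [this, tsum_eq_single []]
  · simp [stackCount]
  · intro s hs
    simp [stackCount, hs]

theorem stackCount_eq_zero_of_length_lt (w : List Bool) : ∀ s : List Bool,
    w.length < s.length → stackCount w s = 0 := by
  induction w with
  | nil => intro s hs; rcases s with - | ⟨y, s⟩ <;> simp [stackCount] at hs ⊢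
  | cons x w ih =>
    intro s hs
    rw [stackCount_cons, ih _ (by simp at hs ⊢; omega)]
    rcases s with - | ⟨y, s⟩
    · simp [popTop]
    · simp [popTop, ih s (by simpa using hs)]

/-- The Cauchy–Schwarz inequality for reflections of words. -/
theorem sq_stackCount_append_le (u v : List Bool) :
    stackCount (u ++ v) [] ^ 2 ≤
      stackCount (u ++ (u.map not).reverse) [] * stackCount ((v.map not).reverse ++ v) [] := by
  have hfin : {s : List Bool | s.length ≤ u.length + v.length}.Finite :=
    List.finite_length_le Bool _
  have key : ∀ a b : List Bool, a.length ≤ u.length + v.length →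
      stackCount ((a.map not).reverse ++ b) [] =
        ∑ s ∈ hfin.toFinset, stackCount a s * stackCount b s := by
    intro a b ha
    have := stackCount_reverse_append a b
    rw [tsum_eq_sum (s := hfin.toFinset)] at this
    · exact_mod_cast this
    · intro s hs
      simp only [Set.Finite.mem_toFinset, Set.mem_ofPred_eq, not_le] at hs
      rw [stackCount_eq_zero_of_length_lt a s (by omega)]
      simp
  set u' := (u.map not).reverse with hu'
  have hu : u = (u'.map not).reverse := by simp [hu', Function.comp_def]
  have hl : u'.length = u.length := by simp [hu']
  rw [hu, key u' v (by omega), key u' u' (by omega), key v v (by omega)]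
  simpa only [sq] using Finset.sum_mul_sq_le_sq_mul_sq hfin.toFinset (stackCount u') (stackCount v)

/-- Cancelling an element `x` inside the initial stack splits the word in two. -/
theorem stackCount_append_cons (x : Bool) (s w : List Bool) : ∀ t : List Bool,
    stackCount w (t ++ x :: s) = ∑ i ∈ Finset.range w.length,
      if w[i]? = some (!x) then stackCount (w.take i) t * stackCount (w.drop (i + 1)) s else 0 := by
  induction w with
  | nil => intro t; simp [stackCount]
  | cons y w ih =>
    intro t
    rw [stackCount_cons, ← List.cons_append, ih, List.length_cons, Finset.sum_range_succ']
    rcases t with - | ⟨z, t⟩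
    · simp only [List.getElem?_cons_succ, List.take_succ_cons, List.drop_succ_cons,
        List.getElem?_cons_zero, stackCount_cons, popTop]
      cases x <;> cases y <;> simp [stackCount]
    · simp only [List.getElem?_cons_succ, List.take_succ_cons, List.drop_succ_cons,
        List.getElem?_cons_zero, stackCount_cons, popTop, List.cons_append, List.take_zero]
      rw [ih]
      by_cases hzy : z = y
      · simp [hzy, stackCount]
      · simp only [ne_eq, hzy, not_false_eq_true, if_true, add_mul]
        simp only [stackCount, reduceCtorEq, if_false, zero_mul, ite_self, add_zero]
        rw [← Finset.sum_add_distrib]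
        refine Finset.sum_congr rfl fun i _ => ?_
        split_ifs <;> rfl

theorem count_eq_of_stackCount_ne_zero (w : List Bool) : ∀ s : List Bool,
    stackCount w s ≠ 0 → (w ++ s).count true = (w ++ s).count false := by
  induction w with
  | nil => intro s h; simp [stackCount] at h; simp [h]
  | cons x w ih =>
    intro s h
    rw [stackCount_cons] at h
    by_cases h1 : stackCount w (x :: s) = 0
    · rw [h1, zero_add] at h
      rcases s with - | ⟨y, s⟩
      · simp [popTop] at h
      · simp only [popTop, ne_eq, ite_eq_right_iff, Classical.not_imp] at h
        have := ih s h.2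
        have := h.1
        cases x <;> cases y <;> simp at * <;> omega
    · have := ih _ h1
      simp [List.count_append, List.count_cons] at *; omega

/-- The **chessboard estimate**: a nonnegative function of cyclic sequences of length `2 * r`
that satisfies the Cauchy–Schwarz inequality for reflections is bounded by the geometric mean of
its values at the constant sequences. -/
theorem pow_le_prod_of_reflection {α : Type*} [Finite α] {r : ℕ} (hr : 0 < r) (f : List α → ℝ)
    (hf : ∀ l, 0 ≤ f l)
    (hrot : ∀ u v : List α, (u ++ v).length = 2 * r → f (u ++ v) = f (v ++ u))
    (hcs : ∀ p q : List α, p.length = r → q.length = r →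
      f (p ++ q) ^ 2 ≤ f (p ++ p.reverse) * f (q.reverse ++ q))
    (hpos : ∀ a, 0 < f (List.replicate (2 * r) a)) {l : List α} (hl : l.length = 2 * r) :
    f l ^ (2 * r) ≤ (l.map fun a => f (List.replicate (2 * r) a)).prod := by
  set W : List α → ℝ := fun l => (l.map fun a => f (List.replicate (2 * r) a)).prod with hW
  have hWpos : ∀ l, 0 < W l := fun l => List.prod_pos (by
    intro x hx
    obtain ⟨a, -, rfl⟩ := List.mem_map.1 hx
    exact hpos a)
  have hWapp : ∀ u v, W (u ++ v) = W u * W v := fun u v => by simp [hW]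
  have hWrev : ∀ u, W u.reverse = W u := fun u => by simp [hW, List.prod_reverse]
  set g : List α → ℝ := fun l => f l ^ (2 * r) / W l with hg
  have hg0 : ∀ l, 0 ≤ g l := fun l => div_nonneg (pow_nonneg (hf l) _) (hWpos l).le
  have hgconst : ∀ a, g (List.replicate (2 * r) a) = 1 := fun a => by
    simp only [hg, hW, List.map_replicate, List.prod_replicate]
    exact div_self (pow_pos (hpos a) _).ne'
  have hgcs : ∀ p q : List α, p.length = r → q.length = r →
      g (p ++ q) ^ 2 ≤ g (p ++ p.reverse) * g (q.reverse ++ q) := by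
    intro p q hp hq
    have h := pow_le_pow_left₀ (sq_nonneg _) (hcs p q hp hq) (2 * r)
    simp only [hg, hWapp, hWrev]
    rw [div_pow, div_mul_div_comm, ← mul_pow, ← pow_mul, mul_comm (2 * r) 2, pow_mul (f _)]
    have : W p * W p * (W q * W q) = (W p * W q) ^ 2 := by ring
    rw [this]
    exact div_le_div_of_nonneg_right h (sq_nonneg _)
  let IsMax : List α → Prop := fun m =>
    m.length = 2 * r ∧ ∀ l : List α, l.length = 2 * r → g l ≤ g m
  have hmrot : ∀ u v, IsMax (u ++ v) → IsMax (v ++ u) := by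
    rintro u v ⟨h1, h2⟩
    refine ⟨by simp at h1 ⊢; omega, fun l hl => ?_⟩
    have : g (v ++ u) = g (u ++ v) := by
      simp only [hg, hWapp, hrot u v h1, mul_comm]
    rw [this]
    exact h2 l hl
  have hmrefl : ∀ p q, p.length = r → IsMax (p ++ q) → IsMax (p ++ p.reverse) := by
    rintro p q hp ⟨h1, h2⟩
    have hq : q.length = r := by simp at h1; omega
    refine ⟨by simp; omega, fun l hl => (h2 l hl).trans ?_⟩
    obtain ⟨a, -⟩ : ∃ a, a ∈ p := List.exists_mem_of_length_pos (by omega)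
    have hM : 0 < g (p ++ q) := by
      have := h2 (List.replicate (2 * r) a) (by simp)
      rw [hgconst] at this
      linarith
    have h3 := hgcs p q hp hq
    have h4 := h2 (q.reverse ++ q) (by simp; omega)
    have h5 := mul_le_mul_of_nonneg_left h4 (hg0 (p ++ p.reverse))
    rw [sq] at h3
    exact le_of_mul_le_mul_right (h3.trans h5) hM
  obtain ⟨m, hm⟩ : ∃ m, IsMax m := by
    obtain ⟨m, hm, hmax⟩ := Set.exists_max_image {l : List α | l.length = 2 * r} g
      (List.finite_length_eq α _) ⟨l, hl⟩
    exact ⟨m, hm, fun l hl => hmax l hl⟩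
  obtain ⟨a, z, rfl⟩ : ∃ a z, m = a :: z := List.exists_cons_of_length_pos (by
    have := hm.1; omega)
  have hrun : ∀ k, k < r → ∃ z, IsMax (List.replicate (k + 1) a ++ z) := by
    intro k
    induction k with
    | zero => exact fun _ => ⟨z, hm⟩
    | succ k ih =>
      intro hk
      obtain ⟨z, hz⟩ := ih (by omega)
      have hlen := hz.1
      simp only [List.length_append, List.length_replicate] at hlen
      have h := hmrefl (List.replicate (k + 1) a ++ z.take (r - (k + 1))) (z.drop (r - (k + 1)))
        (by simp; omega) (by rwa [List.append_assoc, List.take_append_drop])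
      rw [List.reverse_append, List.reverse_replicate, ← List.append_assoc] at h
      have h' := hmrot _ _ h
      rw [List.append_assoc, ← List.append_assoc, ← List.replicate_add,
        show k + 1 + (k + 1) = k + 1 + 1 + k by omega, List.replicate_add, List.append_assoc] at h'
      exact ⟨_, h'⟩
  obtain ⟨z, hz⟩ := hrun (r - 1) (by omega)
  rw [Nat.sub_add_cancel hr] at hz
  have h := hmrefl _ _ (by simp) hz
  rw [List.reverse_replicate, ← List.replicate_add, ← two_mul] at h
  have := h.2 l hl
  rwa [hgconst, hg, div_le_one (hWpos l)] at this

/-- The word with runs of lengths `l`, the letters of the runs alternating and starting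
with `b`. -/
def altWord : Bool → List ℕ → List Bool
  | _, [] => []
  | b, c :: l => List.replicate c b ++ altWord (!b) l

theorem altWord_not (b : Bool) (l : List ℕ) : altWord (!b) l = (altWord b l).map not := by
  induction l generalizing b with
  | nil => rfl
  | cons c l ih => simpa [altWord] using ih (!b)

theorem altWord_append (b : Bool) (u v : List ℕ) :
    altWord b (u ++ v) = altWord b u ++ altWord (b ^^ u.length.bodd) v := by
  induction u generalizing b with
  | nil => simp [altWord]
  | cons c u ih => simp [altWord, ih]

theorem reverse_altWord (b : Bool) (u : List ℕ) :
    ((altWord b u).map not).reverse = altWord (b ^^ u.length.bodd) u.reverse := by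
  induction u generalizing b with
  | nil => simp [altWord]
  | cons c u ih =>
    rw [altWord, List.map_append, List.reverse_append, ih, List.reverse_cons, altWord_append]
    cases b <;> cases h : u.length.bodd <;> simp [altWord, h]

theorem stackCount_altWord_not (b : Bool) (l : List ℕ) :
    stackCount (altWord (!b) l) [] = stackCount (altWord b l) [] := by
  rw [altWord_not]
  exact stackCount_map_not _ []

theorem stackCount_altWord (b c : Bool) (l : List ℕ) :
    stackCount (altWord b l) [] = stackCount (altWord c l) [] := by
  rcases Bool.eq_or_eq_not b c with rfl | rfl
  · rfl
  · exact stackCount_altWord_not c l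

theorem stackCount_altWord_append_comm {u v : List ℕ} (h : Even (u ++ v).length) :
    stackCount (altWord true (u ++ v)) [] = stackCount (altWord true (v ++ u)) [] := by
  have hpar : v.length.bodd = u.length.bodd := by
    rw [List.length_append, Nat.even_iff] at h
    have hu := Nat.mod_two_of_bodd u.length
    have hv := Nat.mod_two_of_bodd v.length
    cases h1 : u.length.bodd <;> cases h2 : v.length.bodd <;> simp [h1, h2] at * <;> omega
  rw [altWord_append, stackCount_append_comm, stackCount_altWord true (true ^^ u.length.bodd) (v ++ u),
    altWord_append, hpar]
  simp

theorem sq_stackCount_altWord_append_le {p q : List ℕ} (h : p.length = q.length) :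
    stackCount (altWord true (p ++ q)) [] ^ 2 ≤
      stackCount (altWord true (p ++ p.reverse)) [] *
        stackCount (altWord true (q.reverse ++ q)) [] := by
  have := sq_stackCount_append_le (altWord true p) (altWord (true ^^ p.length.bodd) q)
  rw [reverse_altWord, reverse_altWord] at this
  rw [altWord_append, altWord_append, altWord_append]
  simpa [h] using this

theorem runsF_eq_altWord {r : ℕ} (n m : Fin r → ℕ) :
    runsF n m = altWord true ((List.finRange r).flatMap fun i => [n i, m i]) := by
  unfold runsF
  induction List.finRange r with
  | nil => rfl
  | cons i l ih => simp [altWord, ih]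

theorem flatMap_pair_const {α : Type*} (l : List α) (k : ℕ) :
    (l.flatMap fun _ => [k, k]) = List.replicate (2 * l.length) k := by
  induction l with
  | nil => rfl
  | cons i l ih => simp [ih, mul_add, List.replicate_succ]

/-- The word `(0^h 1^k 0^(k - h))^r 0^h`, which is `0^h (1^k 0^k)^r` if `h ≤ k`. -/
def rotWord (k h : ℕ) : ℕ → List Bool
  | 0 => List.replicate h false
  | r + 1 => List.replicate h false ++ (List.replicate k true ++
      (List.replicate (k - h) false ++ rotWord k h r))

theorem rotWord_eq {k h : ℕ} (hk : h ≤ k) (r : ℕ) :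
    rotWord k h r = List.replicate h false ++ rotWord k 0 r := by
  induction r with
  | zero => simp [rotWord]
  | succ r ih =>
    rw [rotWord, rotWord, ih]
    simp only [List.replicate_zero, List.nil_append, Nat.sub_zero, ← List.append_assoc]
    rw [List.append_assoc _ (List.replicate (k - h) false), ← List.replicate_add,
      Nat.sub_add_cancel hk]

theorem length_rotWord {k h : ℕ} (hk : h ≤ k) (r : ℕ) :
    (rotWord k h r).length = 2 * k * r + h := by
  induction r with
  | zero => simp [rotWord]
  | succ r ih =>
    simp only [rotWord, List.length_append, List.length_replicate, ih, mul_add]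
    omega

theorem altWord_replicate (k r : ℕ) :
    altWord true (List.replicate (2 * r) k) = rotWord k 0 r := by
  induction r with
  | zero => rfl
  | succ r ih => simp [mul_add, List.replicate_succ, altWord, rotWord, ih]

/-- `φ((1^k 0^k)^r)`. -/
def fussCatalan (k r : ℕ) : ℕ := stackCount (rotWord k 0 r) []

/-- The number of ways to empty a stack of `h` ones by reading `0^h (1^k 0^k)^r`. -/
def fussCatalanStack (k h r : ℕ) : ℕ := stackCount (rotWord k h r) (List.replicate h true)

theorem drop_rotWord {k h : ℕ} (hk : h ≤ k) (d e : ℕ) :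
    (rotWord k h (d + e)).drop (2 * k * d) = rotWord k h e := by
  induction d with
  | zero => simp
  | succ d ih =>
    have h1 : 2 * k * (d + 1) = h + (k + (k - h)) + 2 * k * d := by
      rw [mul_add]; omega
    rw [h1, ← List.drop_drop, show d + 1 + e = (d + e) + 1 by omega, rotWord]
    rw [← List.append_assoc, ← List.append_assoc, List.drop_left' (by simp), ih]

theorem take_rotWord_append {k h : ℕ} (hk : h ≤ k) (d e : ℕ) :
    (rotWord k h (d + e)).take (2 * k * d) ++ List.replicate h false = rotWord k h d := by
  induction d with
  | zero => simp [rotWord]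
  | succ d ih =>
    rw [show d + 1 + e = (d + e) + 1 by omega, rotWord, rotWord, ← ih]
    set u : List Bool := List.replicate h false ++ (List.replicate k true ++
      List.replicate (k - h) false) with hu
    have h1 : 2 * k * (d + 1) = u.length + 2 * k * d := by
      simp [hu, mul_add]; omega
    have h2 : ∀ v : List Bool, List.replicate h false ++ (List.replicate k true ++
        (List.replicate (k - h) false ++ v)) = u ++ v := fun v => by simp [hu]
    rw [h2, h2, h1, List.take_length_add_append, List.append_assoc]

theorem count_rotWord {k h : ℕ} (hk : h ≤ k) (d : ℕ) :
    (rotWord k h d).count false = (rotWord k h d).count true + h := by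
  induction d with
  | zero => simp [rotWord, List.count_replicate]
  | succ d ih => simp [rotWord, List.count_replicate, ih]; omega

theorem stackCount_take_rotWord {k h : ℕ} (hk : h ≤ k) (d e : ℕ) :
    stackCount ((rotWord k h (d + e)).take (2 * k * d)) [] = fussCatalan k d := by
  have h1 := take_rotWord_append hk d e
  rw [rotWord_eq hk d] at h1
  rw [fussCatalan]
  rcases d with - | d
  · simp [rotWord]
  · obtain ⟨u, hu⟩ : ∃ u, (rotWord k h (d + 1 + e)).take (2 * k * (d + 1)) =
        List.replicate h false ++ u := by
      refine ⟨((rotWord k h (d + 1 + e)).take (2 * k * (d + 1))).drop h, ?_⟩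
      conv_lhs => rw [← List.take_append_drop h (List.take _ _)]
      congr 1
      rw [List.take_take, show d + 1 + e = (d + e) + 1 by omega, rotWord,
        min_eq_left (by rw [mul_add]; omega), List.take_left' (by simp)]
    rw [hu, List.append_assoc, List.append_cancel_left_eq] at h1
    rw [hu, stackCount_append_comm, h1]

theorem stackCount_take_rotWord_eq_zero {k h : ℕ} (hk : h ≤ k) (d e j : ℕ) (hj : 0 < j)
    (hjk : j < 2 * k) (hget : (rotWord k h (d + e))[2 * k * d + j]? = some false) :
    stackCount ((rotWord k h (d + e)).take (2 * k * d + j)) [] = 0 := by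
  by_contra hne
  have hc := count_eq_of_stackCount_ne_zero _ _ hne
  have hc1 := count_rotWord hk d
  rw [← take_rotWord_append hk d e] at hc1
  rw [← List.getElem?_drop, drop_rotWord hk] at hget
  rw [List.append_nil, List.take_add, drop_rotWord hk] at hc
  simp only [List.count_append, List.count_replicate, beq_self_eq_true, if_true] at hc hc1
  have hbal : ((rotWord k h e).take j).count true = ((rotWord k h e).take j).count false := by
    simp only [Bool.false_eq_true, beq_iff_eq, if_false] at hc hc1
    omega
  clear hne hc hc1
  rcases e with - | e
  · simp [rotWord, List.getElem?_replicate, List.count_replicate] at hget hbal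
    omega
  · simp only [rotWord, List.getElem?_append, List.getElem?_replicate, List.take_append,
      List.count_replicate, List.length_replicate, List.count_append,
      List.take_replicate] at hget hbal
    have hz : j - h - k - (k - h) = 0 := by omega
    simp only [hz, List.take_zero, List.count_nil] at hbal
    split_ifs at hget <;> simp at hget hbal <;> omega

theorem fussCatalanStack_succ {k h : ℕ} (hk : h < k) (r : ℕ) :
    fussCatalanStack k (h + 1) r =
      ∑ p ∈ Finset.HasAntidiagonal.antidiagonal r, fussCatalan k p.1 * fussCatalanStack k h p.2 := by
  have hpos : 0 < 2 * k := by omega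
  rw [fussCatalanStack, List.replicate_succ]
  have h0 := stackCount_append_cons true (List.replicate h true) (rotWord k (h + 1) r) []
  rw [List.nil_append] at h0
  rw [h0, length_rotWord hk, Finset.Nat.sum_antidiagonal_eq_sum_range_succ_mk]
  symm
  refine Finset.sum_of_injOn (fun d => 2 * k * d) ?_ ?_ ?_ ?_
  · intro a _ b _ hab
    exact Nat.eq_of_mul_eq_mul_left hpos hab
  · intro d hd
    simp only [Finset.coe_range, Set.mem_Iio] at hd ⊢
    have := Nat.mul_le_mul_left (2 * k) (Nat.lt_succ_iff.1 hd)
    omega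
  · intro i hi hni
    split_ifs with hget
    · simp only [Finset.mem_range] at hi
      have hdiv : 2 * k * (i / (2 * k)) + i % (2 * k) = i := Nat.div_add_mod _ _
      have hmod := Nat.mod_lt i hpos
      have hdr : i / (2 * k) ≤ r := by
        by_contra hlt
        have := Nat.mul_le_mul_left (2 * k) (not_le.1 hlt)
        rw [Nat.succ_eq_add_one, mul_add] at this
        omega
      have hj : 0 < i % (2 * k) := by
        rw [Nat.pos_iff_ne_zero]
        intro hz
        exact hni ⟨i / (2 * k), by simpa using Nat.lt_succ_of_le hdr, by simp only; omega⟩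
      have := stackCount_take_rotWord_eq_zero hk (i / (2 * k)) (r - i / (2 * k)) _ hj hmod
      rw [hdiv, Nat.add_sub_cancel' hdr] at this
      rw [this hget, zero_mul]
    · rfl
  · intro d hd
    have hdr : d ≤ r := Nat.lt_succ_iff.1 (Finset.mem_range.1 hd)
    have h1 := drop_rotWord hk d (r - d)
    have h2 := stackCount_take_rotWord hk d (r - d)
    rw [Nat.add_sub_cancel' hdr] at h1 h2
    have h3 : rotWord k (h + 1) (r - d) = false :: rotWord k h (r - d) := by
      rw [rotWord_eq hk, rotWord_eq hk.le]; rfl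
    rw [h3] at h1
    have h4 : (rotWord k (h + 1) r)[2 * k * d]? = some (!true) := by
      rw [← List.head?_drop, h1]; rfl
    rw [if_pos h4, h2, fussCatalanStack, ← List.drop_drop, h1]
    rfl

theorem stackCount_replicate_true_append (w : List Bool) (k j : ℕ) :
    stackCount (List.replicate k true ++ w) (List.replicate j true) =
      stackCount w (List.replicate (k + j) true) := by
  induction k generalizing j with
  | zero => simp
  | succ k ih =>
    rw [List.replicate_succ, List.cons_append, stackCount_cons, ← List.replicate_succ, ih,
      show k + (j + 1) = k + 1 + j by omega]
    cases j <;> simp [popTop, List.replicate_succ]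

theorem fussCatalan_succ (k r : ℕ) : fussCatalan k (r + 1) = fussCatalanStack k k r := by
  have := stackCount_replicate_true_append (rotWord k k r) k 0
  rw [fussCatalanStack, fussCatalan, rotWord]
  rw [rotWord_eq le_rfl] at this ⊢
  simpa using this

open PowerSeries in
theorem mk_fussCatalanStack {k h : ℕ} (hk : h ≤ k) :
    (mk fun r => (fussCatalanStack k h r : ℤ)) = (mk fun r => (fussCatalan k r : ℤ)) ^ (h + 1) := by
  induction h with
  | zero => simp [fussCatalanStack, fussCatalan]
  | succ h ih =>
    rw [pow_succ', ← ih (by omega)]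
    ext r
    simp [coeff_mul, fussCatalanStack_succ hk]

open PowerSeries in
theorem mk_fussCatalan_eq (k : ℕ) :
    (mk fun r => (fussCatalan k r : ℤ)) = 1 + X * (mk fun r => (fussCatalan k r : ℤ)) ^ (k + 1) := by
  rw [← mk_fussCatalanStack le_rfl]
  ext r
  rcases r with - | r
  · simp [fussCatalan, rotWord, stackCount]
  · simp [coeff_succ_X_mul, fussCatalan_succ, coeff_one]

open PowerSeries in
theorem coeff_pow_mul_factorial {R : Type*} [CommRing R] {k : ℕ} {F : PowerSeries R}
    (hF : F = 1 + X * F ^ (k + 1)) (n a : ℕ) :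
    coeff (n + 1) (F ^ a) * ((n + 1).factorial : R) =
      a * ((a + (n + 1) * k + 1).ascFactorial n : R) := by
  have h0 : ∀ a, coeff 0 (F ^ a) = 1 := by
    intro a
    have : constantCoeff F = 1 := by rw [hF]; simp
    simp [this]
  have hrec : ∀ n a, coeff (n + 1) (F ^ (a + 1)) =
      coeff (n + 1) (F ^ a) + coeff n (F ^ (a + k + 1)) := by
    intro n a
    have : F ^ (a + 1) = F ^ a + X * F ^ (a + k + 1) := by
      rw [pow_succ]
      nth_rewrite 2 [hF]
      ring
    rw [this, map_add, coeff_succ_X_mul]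
  induction n generalizing a with
  | zero =>
    induction a with
    | zero => simp [coeff_one]
    | succ a ih =>
      rw [hrec, h0]
      simp at ih ⊢
      rw [ih]
  | succ n ihn =>
    induction a with
    | zero => simp [coeff_one]
    | succ a ih =>
      rw [hrec, add_mul, ih, Nat.factorial_succ (n + 1), Nat.cast_mul, mul_left_comm, ihn]
      have e1 : a + (n + 1 + 1) * k + 1 = a + (n + 2) * k + 1 := by ring
      have e2 : a + k + 1 + (n + 1) * k + 1 = a + (n + 2) * k + 1 + 1 := by ring
      have e3 : a + 1 + (n + 1 + 1) * k + 1 = a + (n + 2) * k + 1 + 1 := by ring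
      have e4 : ∀ y : ℕ, y.ascFactorial (n + 1) = y * (y + 1).ascFactorial n := fun y => by
        rw [add_comm n 1, ← Nat.ascFactorial_mul_ascFactorial]
        simp [Nat.ascFactorial_succ]
      rw [e1, e2, e3, e4, Nat.ascFactorial_succ]
      push_cast
      ring

theorem fussCatalan_mul_factorial (k n : ℕ) :
    fussCatalan k (n + 1) * (n + 1).factorial = ((n + 1) * k + 2).ascFactorial n := by
  have := coeff_pow_mul_factorial (mk_fussCatalan_eq k) n 1
  simp only [pow_one, PowerSeries.coeff_mk, Nat.cast_one, one_mul] at this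
  rw [show 1 + (n + 1) * k + 1 = (n + 1) * k + 2 by ring] at this
  exact_mod_cast this

theorem fussCatalan_pos (k n : ℕ) : 0 < fussCatalan k (n + 1) := by
  have h := fussCatalan_mul_factorial k n
  have h2 := Nat.ascFactorial_pos ((n + 1) * k + 1) n
  rw [← h] at h2
  exact Nat.pos_of_mul_pos_right h2

/-- Log-concavity of the Fuss–Catalan numbers in `k`, as a bound by an exponential tangent. -/
theorem exists_fussCatalan_le_mul_exp (k n : ℕ) : ∃ t : ℝ, 0 ≤ t ∧ ∀ c : ℕ,
    (fussCatalan c (n + 1) : ℝ) ≤ fussCatalan k (n + 1) * Real.exp (t * (c - k)) := by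
  have hden : ∀ i : ℕ, (0 : ℝ) < (n + 1) * k + 2 + i := fun i => by positivity
  refine ⟨∑ i ∈ Finset.range n, ((n + 1 : ℝ) / ((n + 1) * k + 2 + i)),
    Finset.sum_nonneg fun i _ => by have := hden i; positivity, fun c => ?_⟩
  have hfac : (0 : ℝ) < (n + 1).factorial := by positivity
  have hform : ∀ c : ℕ, (fussCatalan c (n + 1) : ℝ) * (n + 1).factorial =
      ∏ i ∈ Finset.range n, ((n + 1 : ℝ) * c + 2 + i) := fun c => by
    have h := fussCatalan_mul_factorial c n
    rw [Nat.ascFactorial_eq_prod_range] at h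
    exact_mod_cast h
  refine le_of_mul_le_mul_right ?_ hfac
  rw [mul_right_comm, hform, hform, Finset.sum_mul, Real.exp_sum, ← Finset.prod_mul_distrib]
  refine Finset.prod_le_prod (fun i _ => by positivity) fun i _ => ?_
  have h1 := Real.add_one_le_exp ((n + 1 : ℝ) / ((n + 1) * k + 2 + i) * (c - k))
  refine le_trans (le_of_eq ?_) (mul_le_mul_of_nonneg_left h1 (hden i).le)
  field_simp [(hden i).ne']
  ring

theorem prod_fussCatalan_le {k n : ℕ} {l : List ℕ} (h : l.sum ≤ l.length * k) :
    (l.map fun c => (fussCatalan c (n + 1) : ℝ)).prod ≤ (fussCatalan k (n + 1) : ℝ) ^ l.length := by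
  obtain ⟨t, ht, hle⟩ := exists_fussCatalan_le_mul_exp k n
  have key : ∀ l : List ℕ, (l.map fun c => (fussCatalan c (n + 1) : ℝ)).prod ≤
      (fussCatalan k (n + 1) : ℝ) ^ l.length *
        Real.exp (t * ((l.sum : ℝ) - l.length * k)) := by
    intro l
    induction l with
    | nil => simp
    | cons c l ih =>
      rw [List.map_cons, List.prod_cons, List.length_cons, List.sum_cons]
      refine (mul_le_mul (hle c) ih (List.prod_nonneg ?_) (by positivity)).trans (le_of_eq ?_)
      · intro x hx
        obtain ⟨c, -, rfl⟩ := List.mem_map.1 hx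
        positivity
      · rw [mul_mul_mul_comm, ← pow_succ', ← Real.exp_add]
        push_cast
        ring_nf
  refine (key l).trans (mul_le_of_le_one_right (by positivity) ?_)
  rw [Real.exp_le_one_iff]
  have : (l.sum : ℝ) ≤ l.length * k := by exact_mod_cast h
  exact mul_nonpos_of_nonneg_of_nonpos ht (by linarith)

/-- The noncommutative Hölder inequality for alternating words. -/
theorem stackCount_altWord_pow_le {r : ℕ} (hr : 0 < r) {l : List ℕ} (hl : l.length = 2 * r) :
    (stackCount (altWord true l) [] : ℝ) ^ (2 * r) ≤
      (l.map fun c => (fussCatalan c r : ℝ)).prod := by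
  have hconst : ∀ c, stackCount (altWord true (List.replicate (2 * r) c)) [] = fussCatalan c r :=
    fun c => by rw [altWord_replicate, fussCatalan]
  have h := pow_le_prod_of_reflection hr
    (fun m : List {c // c ∈ l} => (stackCount (altWord true (m.map Subtype.val)) [] : ℝ))
    (fun _ => Nat.cast_nonneg _) ?_ ?_ ?_ (l := l.attach) (by simpa using hl)
  · simpa only [List.map_replicate, hconst, List.attach_map_subtype_val, List.map_attach_eq_pmap,
      List.pmap_eq_map, List.map_id'] using h
  · intro u v huv
    simp only [List.map_append]
    rw [stackCount_altWord_append_comm]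
    rw [← List.map_append, List.length_map, huv]
    exact even_two_mul r
  · intro p q hp hq
    simp only [List.map_append, List.map_reverse]
    exact_mod_cast sq_stackCount_altWord_append_le (by simp [hp, hq])
  · intro a
    rw [List.map_replicate, hconst, ← Nat.sub_add_cancel hr]
    exact_mod_cast fussCatalan_pos _ _

/-- Main Theorem. For positive `n i`, `m i` with common sum `N`
and `k = ⌈N/r⌉`, `φ(1^{n₁}0^{m₁}⋯1^{n_r}0^{m_r}) ≤ φ((1^k 0^k)^r)`. -/
theorem stmt0 (r : ℕ) (hr : 1 ≤ r) (n m : Fin r → ℕ)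
    (hn : ∀ i, 1 ≤ n i) (hm : ∀ i, 1 ≤ m i)
    (N : ℕ) (hN : ∑ i, n i = N) (hM : ∑ i, m i = N)
    (k : ℕ) (hk : k = ⌈(N : ℚ) / (r : ℚ)⌉₊) :
    phi (runsF n m) ≤ phi (runsF (fun _ : Fin r => k) (fun _ : Fin r => k)) := by
  rw [phi_eq_stackCount, phi_eq_stackCount, runsF_eq_altWord, runsF_eq_altWord, flatMap_pair_const,
    List.length_finRange, altWord_replicate]
  set l := (List.finRange r).flatMap fun i => [n i, m i] with hl
  have hlen : l.length = 2 * r := by simp [hl, List.length_flatMap, mul_comm]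
  have hsum : l.sum = 2 * N := by
    have : ∀ L : List (Fin r), (L.flatMap fun i => [n i, m i]).sum =
        (L.map n).sum + (L.map m).sum := by
      intro L
      induction L with
      | nil => rfl
      | cons i L ih => simp [ih]; omega
    rw [hl, this, ← List.ofFn_eq_map, ← List.ofFn_eq_map, List.sum_ofFn, List.sum_ofFn, hN, hM]
    omega
  have hNk : N ≤ r * k := by
    have h := Nat.le_ceil ((N : ℚ) / r)
    rw [← hk, div_le_iff₀ (by exact_mod_cast hr)] at h
    rw [mul_comm]
    exact_mod_cast h
  have h := stackCount_altWord_pow_le hr hlen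
  obtain ⟨r, rfl⟩ : ∃ s, r = s + 1 := ⟨r - 1, by omega⟩
  have h2 := h.trans (prod_fussCatalan_le (k := k) (by rw [hsum, hlen, mul_assoc]; omega))
  rw [hlen] at h2
  exact_mod_cast le_of_pow_le_pow_left₀ (by omega) (Nat.cast_nonneg _) h2
end

section
/- For all integers n ≥ 1 and r ≥ 1, φ((1^n 0^n)^r) = (1/(nr+1))·C((n+1)r, r), the Fuss–Catalan number C_r^{(n)}, where (1^n 0^n)^r denotes the r-fold concatenation of the word 1^n 0^n. -/
open Finset

/-- `π` is a non-crossing pairing of the integer interval `[a, b)`, given as a set of pairs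
`(i, j)` with `i < j`, that pairs unequal letters of the infinite word `f`. -/
structure IsNCMatching (f : ℕ → Bool) (a b : ℕ) (π : Finset (ℕ × ℕ)) : Prop where
  bound : ∀ i j, (i, j) ∈ π → a ≤ i ∧ i < j ∧ j < b
  cover : ∀ i, a ≤ i → i < b → ∃ j, (i, j) ∈ π ∨ (j, i) ∈ π
  uniq : ∀ i j i' j', (i, j) ∈ π → (i', j') ∈ π →
    (i = i' ∨ i = j' ∨ j = i' ∨ j = j') → i = i' ∧ j = j'
  noncrossing : ∀ i j i' j', (i, j) ∈ π → (i', j') ∈ π → ¬ (i < i' ∧ i' < j ∧ j < j')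
  letter : ∀ i j, (i, j) ∈ π → f i ≠ f j

open Classical in
/-- The finite set of non-crossing matchings of `f` on `[a, b)`. -/
noncomputable def ncMatchings (f : ℕ → Bool) (a b : ℕ) : Finset (Finset (ℕ × ℕ)) :=
  (Ico a b ×ˢ Ico a b).powerset.filter (IsNCMatching f a b)

lemma mem_ncMatchings {f : ℕ → Bool} {a b : ℕ} {π : Finset (ℕ × ℕ)} :
    π ∈ ncMatchings f a b ↔ IsNCMatching f a b π := by
  simp only [ncMatchings, mem_filter, mem_powerset, and_iff_right_iff_imp]
  rintro h ⟨i, j⟩ hij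
  have := h.bound i j hij
  simp only [mem_product, mem_Ico]
  omega

/-- The number of non-crossing matchings of `f` on `[a, b)`. -/
noncomputable def ncCount (f : ℕ → Bool) (a b : ℕ) : ℕ := #(ncMatchings f a b)

lemma ncCount_self (f : ℕ → Bool) (a : ℕ) : ncCount f a a = 1 := by
  rw [ncCount, card_eq_one]
  refine ⟨∅, ?_⟩
  ext π
  rw [mem_ncMatchings, mem_singleton]
  constructor
  · intro h
    refine eq_empty_of_forall_notMem ?_
    rintro ⟨i, j⟩ hij
    have := h.bound i j hij
    omega
  · rintro rfl
    constructor <;> simp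

lemma IsNCMatching.insert_union {f : ℕ → Bool} {a b k : ℕ} {p q : Finset (ℕ × ℕ)}
    (hak : a < k) (hkb : k < b) (hf : f a ≠ f k) (hp : IsNCMatching f (a + 1) k p)
    (hq : IsNCMatching f (k + 1) b q) : IsNCMatching f a b (insert (a, k) (p ∪ q)) := by
  obtain ⟨p1, p2, p3, p4, p5⟩ := hp
  obtain ⟨q1, q2, q3, q4, q5⟩ := hq
  constructor
  · grind
  · intro i hi hib
    rcases lt_trichotomy i k with h | h | h
    · rcases eq_or_lt_of_le hi with rfl | h'
      · exact ⟨k, by simp⟩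
      · obtain ⟨j, hj⟩ := p2 i h' h
        exact ⟨j, by grind⟩
    · exact ⟨a, by simp [h]⟩
    · obtain ⟨j, hj⟩ := q2 i h hib
      exact ⟨j, by grind⟩
  · intro i j i' j' h h'
    simp only [mem_insert, mem_union, Prod.mk.injEq] at h h'
    rcases h with h | h | h <;> rcases h' with h' | h' | h' <;> grind
  · intro i j i' j' h h'
    simp only [mem_insert, mem_union, Prod.mk.injEq] at h h'
    rcases h with h | h | h <;> rcases h' with h' | h' | h' <;> grind
  · intro i j h
    simp only [mem_insert, mem_union, Prod.mk.injEq] at h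
    rcases h with ⟨rfl, rfl⟩ | h | h
    · exact hf
    · exact p5 i j h
    · exact q5 i j h

lemma IsNCMatching.filter_inside {f : ℕ → Bool} {a b k : ℕ} {π : Finset (ℕ × ℕ)}
    (h : IsNCMatching f a b π) (hk : (a, k) ∈ π) :
    IsNCMatching f (a + 1) k (π.filter fun x => a < x.1 ∧ x.2 < k) := by
  obtain ⟨p1, p2, p3, p4, p5⟩ := h
  have := p1 _ _ hk
  constructor
  · grind
  · intro i hi hib
    obtain ⟨j, hj⟩ := p2 i (by omega) (by omega)
    refine ⟨j, ?_⟩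
    simp only [mem_filter]
    rcases hj with hj | hj
    · have := p4 _ _ _ _ hk hj
      have := p3 _ _ _ _ hk hj
      grind
    · have := p4 _ _ _ _ hk hj
      have := p3 _ _ _ _ hk hj
      grind
  · grind
  · grind
  · grind

lemma IsNCMatching.filter_outside {f : ℕ → Bool} {a b k : ℕ} {π : Finset (ℕ × ℕ)}
    (h : IsNCMatching f a b π) (hk : (a, k) ∈ π) :
    IsNCMatching f (k + 1) b (π.filter fun x => k < x.1) := by
  obtain ⟨p1, p2, p3, p4, p5⟩ := h
  have := p1 _ _ hk
  constructor
  · grind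
  · intro i hi hib
    obtain ⟨j, hj⟩ := p2 i (by omega) (by omega)
    refine ⟨j, ?_⟩
    simp only [mem_filter]
    rcases hj with hj | hj
    · grind
    · have := p4 _ _ _ _ hk hj
      have := p3 _ _ _ _ hk hj
      grind
  · grind
  · grind
  · grind

lemma IsNCMatching.eq_insert_union {f : ℕ → Bool} {a b k : ℕ} {π : Finset (ℕ × ℕ)}
    (h : IsNCMatching f a b π) (hk : (a, k) ∈ π) :
    insert (a, k) (π.filter (fun x => a < x.1 ∧ x.2 < k) ∪ π.filter fun x => k < x.1) = π := by
  ext ⟨i, j⟩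
  simp only [mem_insert, mem_union, mem_filter, Prod.mk.injEq]
  constructor
  · grind
  · intro hij
    have := h.bound _ _ hk
    have := h.bound _ _ hij
    have := h.noncrossing _ _ _ _ hk hij
    have := h.uniq _ _ _ _ hk hij
    grind

lemma ncCount_eq_sum_first (f : ℕ → Bool) {a b : ℕ} (hab : a < b) :
    ncCount f a b = ∑ k ∈ Ico (a + 1) b,
      if f a ≠ f k then ncCount f (a + 1) k * ncCount f (k + 1) b else 0 := by
  rw [← sum_filter]
  simp only [ncCount, ← card_product]
  rw [← card_sigma]
  symm
  refine card_bij (fun x _ => insert (a, x.1) (x.2.1 ∪ x.2.2)) ?_ ?_ ?_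
  · rintro ⟨k, p, q⟩ hx
    simp only [mem_sigma, mem_filter, mem_Ico, mem_product, mem_ncMatchings] at hx ⊢
    obtain ⟨⟨⟨h1, h2⟩, h3⟩, hp, hq⟩ := hx
    exact .insert_union h1 h2 h3 hp hq
  · rintro ⟨k, p, q⟩ hx ⟨k', p', q'⟩ hx' heq
    simp only [mem_sigma, mem_filter, mem_Ico, mem_product, mem_ncMatchings] at hx hx' heq
    obtain ⟨⟨⟨h1, h2⟩, h3⟩, hp, hq⟩ := hx
    obtain ⟨⟨⟨h1', h2'⟩, h3'⟩, hp', hq'⟩ := hx'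
    have hmem : ∀ i j, (i = a ∧ j = k ∨ (i, j) ∈ p ∨ (i, j) ∈ q) ↔
        (i = a ∧ j = k' ∨ (i, j) ∈ p' ∨ (i, j) ∈ q') := by
      intro i j
      have := congrArg (fun s => (i, j) ∈ s) heq
      simpa using this
    have bp := hp.bound
    have bq := hq.bound
    have bp' := hp'.bound
    have bq' := hq'.bound
    obtain rfl : k = k' := by
      have := (hmem a k).1 (by simp)
      grind
    obtain rfl : p = p' := by
      ext ⟨i, j⟩
      have := hmem i j
      grind
    obtain rfl : q = q' := by
      ext ⟨i, j⟩
      have := hmem i j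
      grind
    rfl
  · intro π hπ
    rw [mem_ncMatchings] at hπ
    obtain ⟨k, hk⟩ := hπ.cover a le_rfl hab
    have hk : (a, k) ∈ π := by
      rcases hk with hk | hk
      · exact hk
      · have := hπ.bound _ _ hk
        omega
    refine ⟨⟨k, π.filter (fun x => a < x.1 ∧ x.2 < k), π.filter fun x => k < x.1⟩, ?_,
      hπ.eq_insert_union hk⟩
    simp only [mem_sigma, mem_filter, mem_Ico, mem_product, mem_ncMatchings]
    have := hπ.bound _ _ hk
    exact ⟨⟨⟨this.2.1, this.2.2⟩, hπ.letter _ _ hk⟩, hπ.filter_inside hk, hπ.filter_outside hk⟩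

lemma ncCount_succ_eq_sum_last (f : ℕ → Bool) {a b : ℕ} (hab : a ≤ b) :
    ncCount f a (b + 1) = ∑ k ∈ Ico a b,
      if f b ≠ f k then ncCount f a k * ncCount f (k + 1) b else 0 := by
  induction hd : b - a using Nat.strong_induction_on generalizing a b with
  | _ d ih =>
    rcases eq_or_lt_of_le hab with rfl | hlt
    · rw [ncCount_eq_sum_first f (by omega)]
      simp
    rw [ncCount_eq_sum_first f (by omega), sum_Ico_succ_top (by omega),
      sum_eq_sum_Ico_succ_bot hlt, add_comm, ncCount_self, ncCount_self]
    congr 1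
    · simp [eq_comm]
    have hL : ∀ k ∈ Ico (a + 1) b,
        (if f a ≠ f k then ncCount f (a + 1) k * ncCount f (k + 1) (b + 1) else 0) =
        ∑ l ∈ Ico (k + 1) b, if f a ≠ f k ∧ f b ≠ f l then
          ncCount f (a + 1) k * ncCount f (k + 1) l * ncCount f (l + 1) b else 0 := by
      intro k hk
      rw [mem_Ico] at hk
      rw [ih (b - (k + 1)) (by omega) (by omega) rfl, mul_sum]
      split_ifs with h
      · refine sum_congr rfl fun l _ => ?_
        simp [h, mul_assoc]
      · simp [h]
    have hR : ∀ l ∈ Ico (a + 1) b,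
        (if f b ≠ f l then ncCount f a l * ncCount f (l + 1) b else 0) =
        ∑ k ∈ Ico (a + 1) l, if f a ≠ f k ∧ f b ≠ f l then
          ncCount f (a + 1) k * ncCount f (k + 1) l * ncCount f (l + 1) b else 0 := by
      intro l hl
      rw [mem_Ico] at hl
      rw [ncCount_eq_sum_first f (show a < l by omega), sum_mul]
      split_ifs with h
      · refine sum_congr rfl fun l _ => ?_
        simp [h]
      · simp [h]
    rw [sum_congr rfl hL, sum_congr rfl hR]
    exact sum_Ico_Ico_comm' _ _ _

lemma ncCount_rotate_one (f : ℕ → Bool) {a b : ℕ} (hab : a < b) (hf : f a = f b) :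
    ncCount f (a + 1) (b + 1) = ncCount f a b := by
  rw [ncCount_succ_eq_sum_last f (by omega), ncCount_eq_sum_first f hab, hf]

lemma ncCount_rotate (f : ℕ → Bool) {L : ℕ} (hf : ∀ i, f (i + L) = f i) (a : ℕ) :
    ncCount f a (a + L) = ncCount f 0 L := by
  rcases Nat.eq_zero_or_pos L with rfl | hL
  · simp [ncCount_self]
  induction a with
  | zero => simp
  | succ a ih =>
    rw [← ih, add_right_comm]
    exact ncCount_rotate_one f (by omega) (hf a).symm

lemma height_eq_of_ncCount_ne_zero {f : ℕ → Bool} {h : ℕ → ℤ}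
    (hh : ∀ i, h (i + 1) = h i + if f i then 1 else -1) {a b : ℕ} (hab : a ≤ b)
    (hne : ncCount f a b ≠ 0) : h a = h b := by
  induction hd : b - a using Nat.strong_induction_on generalizing a b with
  | _ d ih =>
    rcases eq_or_lt_of_le hab with rfl | hlt
    · rfl
    rw [ncCount_eq_sum_first f hlt] at hne
    obtain ⟨k, hk, hne⟩ := exists_ne_zero_of_sum_ne_zero hne
    rw [mem_Ico] at hk
    rw [ite_ne_right_iff, mul_ne_zero_iff] at hne
    obtain ⟨hf, h1, h2⟩ := hne
    have e1 := ih (k - (a + 1)) (by omega) (by omega) h1 rfl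
    have e2 := ih (b - (k + 1)) (by omega) (by omega) h2 rfl
    have ea := hh a
    have ek := hh k
    cases ha : f a <;> cases hb : f k <;> simp only [ha, hb, ne_eq, not_true_eq_false] at hf ea ek
    all_goals
      simp only [if_true, if_false, Bool.false_eq_true] at ea ek
      omega

/-- The periodic infinite word `1ⁿ0ⁿ1ⁿ0ⁿ⋯`. -/
def blockWord (n i : ℕ) : Bool := decide (i % (2 * n) < n)

/-- The height of the lattice path of `blockWord n` after `i` steps. -/
def blockHeight (n i : ℕ) : ℤ :=
  if i % (2 * n) ≤ n then ((i % (2 * n) : ℕ) : ℤ) else 2 * n - ((i % (2 * n) : ℕ) : ℤ)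

lemma blockWord_add_mul (n i g : ℕ) : blockWord n (i + 2 * n * g) = blockWord n i := by
  simp [blockWord]

lemma blockHeight_succ {n : ℕ} (hn : 1 ≤ n) (i : ℕ) :
    blockHeight n (i + 1) = blockHeight n i + if blockWord n i then 1 else -1 := by
  have hlt := Nat.mod_lt i (show 2 * n > 0 by omega)
  have hs : (i + 1) % (2 * n) = if i % (2 * n) + 1 = 2 * n then 0 else i % (2 * n) + 1 := by
    rw [Nat.add_mod_eq_ite, Nat.mod_eq_of_lt (show 1 < 2 * n by omega)]
    split_ifs <;> omega
  simp only [blockHeight, blockWord, decide_eq_true_eq]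
  generalize i % (2 * n) = x at *
  generalize (i + 1) % (2 * n) = y at *
  split_ifs at hs ⊢ <;> omega

/-- The number of non-crossing matchings of `(1ⁿ0ⁿ)^g`. -/
noncomputable def blockCount (n g : ℕ) : ℕ := ncCount (blockWord n) 0 (2 * n * g)

lemma ncCount_blockWord_rotate (n a g : ℕ) :
    ncCount (blockWord n) a (a + 2 * n * g) = blockCount n g :=
  ncCount_rotate _ (fun i => blockWord_add_mul n i g) a

/-- The number of non-crossing matchings of `1ᵏ(0ⁿ1ⁿ)ᵐ0ᵏ`. -/
noncomputable def innerCount (n k m : ℕ) : ℕ :=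
  ncCount (blockWord n) (n - k) (n + k + 2 * n * m)

lemma innerCount_zero (n m : ℕ) : innerCount n 0 m = blockCount n m := by
  simpa [innerCount] using ncCount_blockWord_rotate n n m

lemma innerCount_self (n m : ℕ) : innerCount n n m = blockCount n (m + 1) := by
  rw [innerCount, blockCount, Nat.sub_self]
  congr 1
  ring

lemma innerCount_succ {n k : ℕ} (hk : k + 1 ≤ n) (m : ℕ) :
    innerCount n (k + 1) m =
      ∑ i ∈ range (m + 1), innerCount n k i * blockCount n (m - i) := by
  have hstart : blockWord n (n - (k + 1)) = true := by
    simp only [blockWord, decide_eq_true_eq]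
    rw [Nat.mod_eq_of_lt] <;> omega
  have hmod : ∀ i, (n + k + 2 * n * i) % (2 * n) = n + k := by
    intro i
    rw [Nat.add_mul_mod_self_left, Nat.mod_eq_of_lt (by omega)]
  rw [innerCount, ncCount_eq_sum_first _ (by omega)]
  symm
  refine sum_of_injOn (fun i => n + k + 2 * n * i) ?_ ?_ ?_ ?_
  · intro i _ j _ hij
    have : 2 * n * i = 2 * n * j := by simpa using hij
    exact Nat.eq_of_mul_eq_mul_left (by omega) this
  · intro i hi
    simp only [coe_range, Set.mem_Iio, coe_Ico, Set.mem_Ico] at hi ⊢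
    have : 2 * n * i ≤ 2 * n * m := Nat.mul_le_mul_left _ (by omega)
    omega
  · intro c hc hnot
    rw [mem_Ico] at hc
    rw [ite_eq_right_iff, hstart]
    intro hf
    by_contra hne
    have hin := height_eq_of_ncCount_ne_zero (blockHeight_succ (by omega)) hc.1
      (left_ne_zero_of_mul hne)
    have hfc : blockWord n c = false := by simpa using hf.symm
    have hs := blockHeight_succ (n := n) (by omega) (n - (k + 1))
    rw [hstart, hin] at hs
    have h0 : blockHeight n (n - (k + 1)) = n - (k + 1) := by
      rw [blockHeight, Nat.mod_eq_of_lt (by omega), if_pos (by omega)]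
      omega
    have hlt := Nat.mod_lt c (show 2 * n > 0 by omega)
    have hcm : c % (2 * n) = n + k := by
      simp only [blockWord, decide_eq_false_iff_not] at hfc
      rw [h0, blockHeight, if_pos rfl] at hs
      clear hnot hne hin
      generalize c % (2 * n) = x at *
      split_ifs at hs <;> omega
    have hdiv := Nat.mod_add_div c (2 * n)
    apply hnot
    refine ⟨c / (2 * n), ?_, by simp only; omega⟩
    simp only [coe_range, Set.mem_Iio]
    by_contra hle
    have : 2 * n * (m + 1) ≤ 2 * n * (c / (2 * n)) := Nat.mul_le_mul_left _ (by omega)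
    rw [mul_add] at this
    omega
  · intro i hi
    rw [mem_range] at hi
    have hf : blockWord n (n + k + 2 * n * i) = false := by
      simp [blockWord]
      rw [Nat.mod_eq_of_lt] <;> omega
    simp only [hstart, hf]
    rw [← ncCount_blockWord_rotate n (n + k + 2 * n * i + 1) (m - i), innerCount]
    have e1 : n - (k + 1) + 1 = n - k := by omega
    have e2 : n + k + 2 * n * i + 1 + 2 * n * (m - i) = n + (k + 1) + 2 * n * m := by
      obtain ⟨d, rfl⟩ := Nat.exists_eq_add_of_le (Nat.lt_succ_iff.1 hi)
      rw [Nat.add_sub_cancel_left]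
      ring
    rw [e1, e2]
    simp

open PowerSeries in
lemma mk_blockCount_eq {n : ℕ} :
    (PowerSeries.mk (blockCount n)) = 1 + X * (PowerSeries.mk (blockCount n)) ^ (n + 1) := by
  have hpow : ∀ k ≤ n, PowerSeries.mk (innerCount n k) =
      (PowerSeries.mk (blockCount n)) ^ (k + 1) := by
    intro k
    induction k with
    | zero =>
      intro _
      ext m
      simp [innerCount_zero]
    | succ k ih =>
      intro hk
      rw [pow_succ, ← ih (by omega)]
      ext m
      rw [coeff_mul, Nat.sum_antidiagonal_eq_sum_range_succ_mk]
      simpa using innerCount_succ hk m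
  rw [← hpow n le_rfl]
  ext m
  cases m with
  | zero => simp [blockCount, ncCount_self]
  | succ m => simp [coeff_succ_X_mul, innerCount_self, coeff_one]

open PowerSeries in
/-- The coefficients of the powers of a solution of `B = 1 + X * B ^ p`. -/
lemma coeff_pow_mul_of_eq_one_add {p : ℕ} {B : PowerSeries ℕ} (hB : B = 1 + X * B ^ p)
    (hp : 1 ≤ p) (r s : ℕ) :
    coeff r (B ^ s) * (p * r + s) = s * (p * r + s).choose r := by
  have h0 : constantCoeff B = 1 := by
    rw [hB]
    simp
  induction r generalizing s with
  | zero => simp [h0]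
  | succ r ihr =>
    induction s with
    | zero => simp [coeff_one]
    | succ s ihs =>
      have hrec : coeff (r + 1) (B ^ (s + 1)) =
          coeff (r + 1) (B ^ s) + coeff r (B ^ (s + p)) := by
        have hstep : B ^ (s + 1) = B ^ s * (1 + X * B ^ p) := by rw [← hB, pow_succ]
        rw [hstep, mul_add, mul_one, map_add, mul_left_comm, coeff_succ_X_mul, ← pow_add]
      have h1 := ihr (s + p)
      obtain ⟨N, hN⟩ : ∃ N, N = p * r + p + s := ⟨_, rfl⟩
      rw [show p * r + (s + p) = N by rw [hN]; ring] at h1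
      rw [show p * (r + 1) + s = N by rw [hN]; ring] at ihs
      rw [hrec, show p * (r + 1) + (s + 1) = N + 1 by rw [hN]; ring]
      have hNpos : 0 < N := by omega
      have hrN : r ≤ N := by nlinarith
      have c1 := Nat.choose_succ_right_eq N r
      have c2 := Nat.add_one_mul_choose_eq N r
      generalize coeff (r + 1) (B ^ s) = x at *
      generalize coeff r (B ^ (s + p)) = y at *
      zify [hrN] at *
      have hrz : ((r : ℤ) + 1) ≠ 0 := by positivity
      have hNz : (N : ℤ) ≠ 0 := by positivity
      apply mul_left_cancel₀ (mul_ne_zero hrz hNz)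
      linear_combination ((r : ℤ) + 1) * (N + 1) * (ihs + h1) + (N + 1) * s * c1 +
        (s + 1) * N * c2 - (N + 1) * (N.choose r) * hN

lemma blockCount_mul (n r : ℕ) :
    blockCount n r * (n * r + 1) = ((n + 1) * r).choose r := by
  have h := coeff_pow_mul_of_eq_one_add (mk_blockCount_eq (n := n)) (by omega) r 1
  rw [pow_one, PowerSeries.coeff_mk, one_mul] at h
  have h2 := Nat.choose_mul_succ_eq ((n + 1) * r) r
  have h3 : (n + 1) * r + 1 - r = n * r + 1 := by
    rw [add_mul, one_mul]
    omega
  rw [h3] at h2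
  refine Nat.eq_of_mul_eq_mul_right (Nat.succ_pos ((n + 1) * r)) ?_
  rw [Nat.succ_eq_add_one, h2, ← h]
  ring

/-- The pairs `(i, j)`, `i < j`, of the values of the elements of two-element blocks of `π`. -/
def blockPairs {N : ℕ} (π : Finset (Finset (Fin N))) : Finset (ℕ × ℕ) :=
  ((univ : Finset (Fin N × Fin N)).filter fun x => x.1 < x.2 ∧ {x.1, x.2} ∈ π).image
    fun x => (x.1.val, x.2.val)

lemma mem_blockPairs {N : ℕ} {π : Finset (Finset (Fin N))} {x : ℕ × ℕ} :
    x ∈ blockPairs π ↔ ∃ i j : Fin N, i < j ∧ {i, j} ∈ π ∧ x = (i.val, j.val) := by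
  simp only [blockPairs, mem_image, mem_filter, mem_univ, true_and, Prod.exists]
  constructor
  · rintro ⟨i, j, ⟨h1, h2⟩, rfl⟩
    exact ⟨i, j, h1, h2, rfl⟩
  · rintro ⟨i, j, h1, h2, rfl⟩
    exact ⟨i, j, ⟨h1, h2⟩, rfl⟩

lemma mk_mem_blockPairs {N : ℕ} {π : Finset (Finset (Fin N))} {i j : Fin N} :
    (i.val, j.val) ∈ blockPairs π ↔ i < j ∧ {i, j} ∈ π := by
  rw [mem_blockPairs]
  constructor
  · rintro ⟨i', j', h1, h2, h⟩
    rw [Prod.mk.injEq, Fin.val_inj, Fin.val_inj] at h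
    obtain ⟨rfl, rfl⟩ := h
    exact ⟨h1, h2⟩
  · rintro ⟨h1, h2⟩
    exact ⟨i, j, h1, h2, rfl⟩

lemma exists_lt_eq_pair {N : ℕ} {B : Finset (Fin N)} (hB : #B = 2) :
    ∃ i j, i < j ∧ B = {i, j} := by
  obtain ⟨i, j, hne, rfl⟩ := card_eq_two.1 hB
  rcases lt_or_gt_of_ne hne with h | h
  · exact ⟨i, j, h, rfl⟩
  · exact ⟨j, i, h, pair_comm i j⟩

lemma pair_eq_pair_of_lt {N : ℕ} {i j i' j' : Fin N} (h : i < j) (h' : i' < j')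
    (heq : ({i, j} : Finset (Fin N)) = {i', j'}) : i = i' ∧ j = j' := by
  have h1 : i ∈ ({i', j'} : Finset (Fin N)) := heq ▸ by simp
  have h2 : j ∈ ({i', j'} : Finset (Fin N)) := heq ▸ by simp
  simp only [mem_insert, mem_singleton] at h1 h2
  omega

lemma blockPairs_injOn {N : ℕ} :
    Set.InjOn (blockPairs (N := N)) {π | ∀ B ∈ π, #B = 2} := by
  have key : ∀ π π' : Finset (Finset (Fin N)), (∀ B ∈ π, #B = 2) →
      blockPairs π = blockPairs π' → π ⊆ π' := by
    intro π π' h heq B hB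
    obtain ⟨i, j, hij, rfl⟩ := exists_lt_eq_pair (h B hB)
    exact (mk_mem_blockPairs.1 (heq ▸ mk_mem_blockPairs.2 ⟨hij, hB⟩)).2
  intro π h π' h' heq
  exact (key π π' h heq).antisymm (key π' π h' heq.symm)

lemma IsNCPairingOn.isNCMatching {w : List Bool} {f : ℕ → Bool}
    (hf : ∀ i : Fin w.length, w.get i = f i) {π : Finset (Finset (Fin w.length))}
    (h : IsNCPairingOn w π) : IsNCMatching f 0 w.length (blockPairs π) := by
  obtain ⟨⟨hcard, hcov⟩, hnc, hlet⟩ := h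
  constructor
  · intro i j hij
    obtain ⟨i, j, hlt, -, heq⟩ := mem_blockPairs.1 hij
    obtain ⟨rfl, rfl⟩ := Prod.mk.inj heq
    exact ⟨Nat.zero_le _, hlt, j.2⟩
  · intro i _ hi
    obtain ⟨B, ⟨hB, hiB⟩, -⟩ := hcov ⟨i, hi⟩
    obtain ⟨k, l, hkl, rfl⟩ := exists_lt_eq_pair (hcard B hB)
    have hmem := mk_mem_blockPairs.2 ⟨hkl, hB⟩
    simp only [mem_insert, mem_singleton] at hiB
    rcases hiB with rfl | rfl
    · exact ⟨l, .inl hmem⟩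
    · exact ⟨k, .inr hmem⟩
  · intro i j i' j' hij hij' hshare
    obtain ⟨i, j, hlt, hB, heq⟩ := mem_blockPairs.1 hij
    obtain ⟨rfl, rfl⟩ := Prod.mk.inj heq
    obtain ⟨i', j', hlt', hB', heq⟩ := mem_blockPairs.1 hij'
    obtain ⟨rfl, rfl⟩ := Prod.mk.inj heq
    simp only [Fin.val_inj] at hshare ⊢
    refine pair_eq_pair_of_lt hlt hlt' ?_
    rcases hshare with rfl | rfl | rfl | rfl
    · exact (hcov i).unique ⟨hB, by simp⟩ ⟨hB', by simp⟩
    · exact (hcov i).unique ⟨hB, by simp⟩ ⟨hB', by simp⟩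
    · exact (hcov j).unique ⟨hB, by simp⟩ ⟨hB', by simp⟩
    · exact (hcov j).unique ⟨hB, by simp⟩ ⟨hB', by simp⟩
  · intro i j i' j' hij hij' hcross
    obtain ⟨i, j, hlt, hB, heq⟩ := mem_blockPairs.1 hij
    obtain ⟨rfl, rfl⟩ := Prod.mk.inj heq
    obtain ⟨i', j', hlt', hB', heq⟩ := mem_blockPairs.1 hij'
    obtain ⟨rfl, rfl⟩ := Prod.mk.inj heq
    exact hnc ⟨_, hB, _, hB', i, j, i', j', by simp, by simp, by simp, by simp, hcross⟩
  · intro i j hij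
    obtain ⟨i, j, hlt, hB, heq⟩ := mem_blockPairs.1 hij
    obtain ⟨rfl, rfl⟩ := Prod.mk.inj heq
    rw [← hf, ← hf]
    exact hlet _ hB i (by simp) j (by simp) hlt.ne

lemma IsNCMatching.exists_blockPairs_eq {w : List Bool} {f : ℕ → Bool}
    (hf : ∀ i : Fin w.length, w.get i = f i) {p : Finset (ℕ × ℕ)}
    (h : IsNCMatching f 0 w.length p) :
    ∃ π : Finset (Finset (Fin w.length)), IsNCPairingOn w π ∧ blockPairs π = p := by
  classical
  set π : Finset (Finset (Fin w.length)) :=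
    univ.filter fun B => ∃ i j : Fin w.length, B = {i, j} ∧ (i.val, j.val) ∈ p with hπ
  have hmem : ∀ B, B ∈ π ↔ ∃ i j : Fin w.length, B = {i, j} ∧ (i.val, j.val) ∈ p := by
    simp [hπ]
  have hlt : ∀ i j : Fin w.length, (i.val, j.val) ∈ p → i < j := fun i j hij =>
    (h.bound _ _ hij).2.1
  refine ⟨π, ⟨⟨?_, ?_⟩, ?_, ?_⟩, ?_⟩
  · intro B hB
    obtain ⟨i, j, rfl, hij⟩ := (hmem B).1 hB
    exact card_pair (hlt i j hij).ne
  · intro i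
    have hex : ∃ B, B ∈ π ∧ i ∈ B := by
      obtain ⟨j, hj | hj⟩ := h.cover i (Nat.zero_le _) i.2
      · have := h.bound _ _ hj
        exact ⟨{i, ⟨j, this.2.2⟩}, (hmem _).2 ⟨_, _, rfl, hj⟩, by simp⟩
      · have := h.bound _ _ hj
        exact ⟨{⟨j, by omega⟩, i}, (hmem _).2 ⟨_, _, rfl, hj⟩, by simp⟩
    refine existsUnique_of_exists_of_unique hex ?_
    rintro B C ⟨hB, hiB⟩ ⟨hC, hiC⟩
    obtain ⟨k, l, rfl, hkl⟩ := (hmem B).1 hB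
    obtain ⟨k', l', rfl, hkl'⟩ := (hmem C).1 hC
    simp only [mem_insert, mem_singleton] at hiB hiC
    have := h.uniq _ _ _ _ hkl hkl' (by simp only [Fin.val_inj]; grind)
    rw [Fin.val_inj, Fin.val_inj] at this
    rw [this.1, this.2]
  · rintro ⟨B, hB, C, hC, i₁, i₂, j₁, j₂, hi₁, hi₂, hj₁, hj₂, h1, h2, h3⟩
    obtain ⟨k, l, rfl, hkl⟩ := (hmem B).1 hB
    obtain ⟨k', l', rfl, hkl'⟩ := (hmem C).1 hC
    have := hlt _ _ hkl
    have := hlt _ _ hkl'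
    simp only [mem_insert, mem_singleton] at hi₁ hi₂ hj₁ hj₂
    exact h.noncrossing _ _ _ _ hkl hkl' (by omega)
  · intro B hB i hi j hj hne
    obtain ⟨k, l, rfl, hkl⟩ := (hmem B).1 hB
    have := h.letter _ _ hkl
    rw [← hf, ← hf] at this
    simp only [mem_insert, mem_singleton] at hi hj
    rcases hi with rfl | rfl <;> rcases hj with rfl | rfl
    · exact absurd rfl hne
    · exact this
    · exact this.symm
    · exact absurd rfl hne
  · ext ⟨i, j⟩
    rw [mem_blockPairs]
    constructor
    · rintro ⟨k, l, hkl, hB, heq⟩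
      rw [heq]
      obtain ⟨k', l', hB', hkl'⟩ := (hmem _).1 hB
      obtain ⟨rfl, rfl⟩ := pair_eq_pair_of_lt hkl (hlt _ _ hkl') hB'
      exact hkl'
    · intro hij
      have := h.bound _ _ hij
      exact ⟨⟨i, by omega⟩, ⟨j, by omega⟩, this.2.1, (hmem _).2 ⟨_, _, rfl, hij⟩, rfl⟩

lemma phi_eq_ncCount {w : List Bool} {f : ℕ → Bool}
    (hf : ∀ i : Fin w.length, w.get i = f i) : phi w = ncCount f 0 w.length := by
  have himage : blockPairs '' {π | IsNCPairingOn w π} = (ncMatchings f 0 w.length : Set _) := by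
    ext p
    simp only [Set.mem_image, Set.mem_ofPred_eq, mem_coe, mem_ncMatchings]
    constructor
    · rintro ⟨π, hπ, rfl⟩
      exact hπ.isNCMatching hf
    · exact fun h => h.exists_blockPairs_eq hf
  rw [phi, ncCount, ← Set.ncard_coe_finset, ← himage, Set.InjOn.ncard_image]
  exact blockPairs_injOn.mono fun π hπ => hπ.1.1

lemma runsF_const (n r : ℕ) :
    runsF (fun _ : Fin r => n) (fun _ : Fin r => n) =
      (List.range (2 * n * r)).map (blockWord n) := by
  have hblock : (List.range (2 * n)).map (blockWord n) =
      List.replicate n true ++ List.replicate n false := by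
    rw [two_mul, List.range_add, List.map_append, List.map_map]
    congr 1 <;> rw [List.eq_replicate_iff] <;> simp only [List.length_map, List.length_range,
      List.mem_map, List.mem_range, Function.comp_apply, true_and] <;> rintro _ ⟨i, hi, rfl⟩
    · simp only [blockWord, decide_eq_true_eq]
      rwa [Nat.mod_eq_of_lt (by omega)]
    · simp only [blockWord, decide_eq_false_iff_not]
      rw [Nat.mod_eq_of_lt (by omega)]
      omega
  have hrep : runsF (fun _ : Fin r => n) (fun _ : Fin r => n) =
      (List.replicate r (List.replicate n true ++ List.replicate n false)).flatten := by
    rw [runsF, List.flatMap_def, List.map_const', List.length_finRange]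
  rw [hrep]
  clear hrep
  induction r with
  | zero => simp
  | succ r ih =>
    rw [List.replicate_succ, List.flatten_cons, ih, mul_add_one, add_comm, List.range_add,
      List.map_append, hblock, List.map_map]
    congr 2
    funext i
    simpa [add_comm] using (blockWord_add_mul n i 1).symm

/-- `φ((1^n 0^n)^r) = (1/(nr+1)) · C((n+1)r, r)`, the Fuss–Catalan
number (stated multiplicatively over ℕ). -/
theorem stmt1 (n r : ℕ) (hn : 1 ≤ n) (hr : 1 ≤ r) :
    phi (runsF (fun _ : Fin r => n) (fun _ : Fin r => n)) * (n * r + 1) =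
      Nat.choose ((n + 1) * r) r := by
  rw [← blockCount_mul, runsF_const, phi_eq_ncCount (f := blockWord n) (by simp),
    List.length_map, List.length_range, blockCount]
end

section
/- Let S = 1^{n_1}0^{m_1}⋯1^{n_r}0^{m_r} with all n_j, m_j ≥ 1 and n_1+⋯+n_r = m_1+⋯+m_r, and let i = min{n_1, m_1, …, n_r, m_r}. Then φ(S) ≥ (1+i)^{r−1}. -/
/-- The blocks of `π` pushed forward along `f`, together with the blocks in `E`. -/
def pushBlocks {N M : ℕ} (f : Fin N → Fin M) (E : Finset (Finset (Fin M)))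
    (π : Finset (Finset (Fin N))) : Finset (Finset (Fin M)) :=
  π.image (Finset.image f) ∪ E

theorem mem_pushBlocks {N M : ℕ} {f : Fin N → Fin M} {E : Finset (Finset (Fin M))}
    {π : Finset (Finset (Fin N))} {B : Finset (Fin M)} :
    B ∈ pushBlocks f E π ↔ (∃ A ∈ π, A.image f = B) ∨ B ∈ E := by
  simp [pushBlocks]

theorem IsPairing.nonempty_of_mem {N : ℕ} {π : Finset (Finset (Fin N))} (h : IsPairing π)
    {B : Finset (Fin N)} (hB : B ∈ π) : B.Nonempty := by
  rw [← Finset.card_pos, h.1 B hB]; norm_num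

theorem pushBlocks_injOn {N M : ℕ} {f : Fin N → Fin M} (hf : Function.Injective f)
    {E : Finset (Finset (Fin M))} (hE : ∀ B ∈ E, ∀ i ∈ B, i ∉ Set.range f) :
    Set.InjOn (pushBlocks f E) {π | IsPairing π} := by
  have key : ∀ π π' : Finset (Finset (Fin N)), IsPairing π →
      pushBlocks f E π = pushBlocks f E π' → π ⊆ π' := by
    intro π π' h heq B hB
    have h1 : B.image f ∈ pushBlocks f E π' := by
      rw [← heq, mem_pushBlocks]; exact Or.inl ⟨B, hB, rfl⟩
    rcases mem_pushBlocks.1 h1 with ⟨A, hA, hAB⟩ | h2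
    · rwa [← Finset.image_injective hf hAB]
    · obtain ⟨x, hx⟩ := h.nonempty_of_mem hB
      exact absurd ⟨x, rfl⟩ (hE _ h2 (f x) (Finset.mem_image_of_mem f hx))
  intro π h π' h' heq
  exact Finset.Subset.antisymm (key _ _ h heq) (key _ _ h' heq.symm)

theorem IsPairing.pushBlocks {N M : ℕ} {f : Fin N → Fin M} (hf : Function.Injective f)
    {E : Finset (Finset (Fin M))} (hE : ∀ B ∈ E, ∀ i ∈ B, i ∉ Set.range f)
    (hcard : ∀ B ∈ E, B.card = 2) (hcover : ∀ i, i ∉ Set.range f → ∃! B, B ∈ E ∧ i ∈ B)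
    {π : Finset (Finset (Fin N))} (h : IsPairing π) : IsPairing (pushBlocks f E π) := by
  refine ⟨?_, ?_⟩
  · intro B hB
    rcases mem_pushBlocks.1 hB with ⟨A, hA, rfl⟩ | hB
    · rw [Finset.card_image_of_injective _ hf, h.1 A hA]
    · exact hcard B hB
  · intro i
    by_cases hi : i ∈ Set.range f
    · obtain ⟨j, rfl⟩ := hi
      obtain ⟨A, ⟨hA, hjA⟩, huniq⟩ := h.2 j
      refine ⟨A.image f, ⟨mem_pushBlocks.2 (Or.inl ⟨A, hA, rfl⟩),
        Finset.mem_image_of_mem f hjA⟩, ?_⟩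
      rintro B ⟨hB, hjB⟩
      rcases mem_pushBlocks.1 hB with ⟨A', hA', rfl⟩ | hB
      · rw [hf.mem_finset_image] at hjB
        rw [huniq A' ⟨hA', hjB⟩]
      · exact absurd ⟨j, rfl⟩ (hE B hB _ hjB)
    · obtain ⟨B, ⟨hB, hiB⟩, huniq⟩ := hcover i hi
      refine ⟨B, ⟨mem_pushBlocks.2 (Or.inr hB), hiB⟩, ?_⟩
      rintro C ⟨hC, hiC⟩
      rcases mem_pushBlocks.1 hC with ⟨A, hA, rfl⟩ | hC
      · obtain ⟨j, -, rfl⟩ := Finset.mem_image.1 hiC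
        exact absurd ⟨j, rfl⟩ hi
      · exact huniq C ⟨hC, hiC⟩

/-- The embedding of positions of `u ++ v` into those of `u ++ x :: y :: v`. -/
def insertMap (u v : List Bool) (x y : Bool) (i : Fin (u ++ v).length) :
    Fin (u ++ x :: y :: v).length :=
  ⟨if (i : ℕ) < u.length then i else i + 2, by
    have := i.2
    simp only [List.length_append, List.length_cons] at this ⊢
    split <;> omega⟩

/-- The block formed by the two letters inserted between `u` and `v`. -/
def newBlock (u v : List Bool) (x y : Bool) : Finset (Fin (u ++ x :: y :: v).length) :=
  {⟨u.length, by simp⟩, ⟨u.length + 1, by simp⟩}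

theorem mem_newBlock {u v : List Bool} {x y : Bool} {i : Fin (u ++ x :: y :: v).length} :
    i ∈ newBlock u v x y ↔ (i : ℕ) = u.length ∨ (i : ℕ) = u.length + 1 := by
  simp [newBlock, Fin.ext_iff]

theorem insertMap_strictMono (u v : List Bool) (x y : Bool) :
    StrictMono (insertMap u v x y) := by
  intro i j hij
  simp only [insertMap, Fin.lt_def] at hij ⊢
  split <;> split <;> omega

theorem mem_range_insertMap {u v : List Bool} {x y : Bool}
    {i : Fin (u ++ x :: y :: v).length} :
    i ∈ Set.range (insertMap u v x y) ↔ i ∉ newBlock u v x y := by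
  rw [mem_newBlock]
  constructor
  · rintro ⟨j, rfl⟩
    simp only [insertMap]
    split <;> omega
  · intro h
    have hi := i.2
    simp only [List.length_append, List.length_cons] at hi
    by_cases hlt : (i : ℕ) < u.length
    · exact ⟨⟨i, by simp only [List.length_append]; omega⟩, by simp [insertMap, hlt]⟩
    · refine ⟨⟨i - 2, by simp only [List.length_append]; omega⟩, ?_⟩
      simp only [insertMap, Fin.ext_iff]
      split <;> omega

theorem get_insertMap (u v : List Bool) (x y : Bool) (i : Fin (u ++ v).length) :
    (u ++ x :: y :: v).get (insertMap u v x y i) = (u ++ v).get i := by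
  by_cases h : (i : ℕ) < u.length
  · simp [insertMap, h]
  · have h1 : (i : ℕ) + 2 - u.length = (i : ℕ) - u.length + 1 + 1 := by omega
    have h2 : ¬ (i : ℕ) + 2 < u.length := by omega
    simp [insertMap, h, h1, h2, List.getElem_append]

/-- Pair up two letters inserted between `u` and `v`. -/
def insertPair (u v : List Bool) (x y : Bool) :
    Finset (Finset (Fin (u ++ v).length)) →
      Finset (Finset (Fin (u ++ x :: y :: v).length)) :=
  pushBlocks (insertMap u v x y) {newBlock u v x y}

theorem insertPair_injOn (u v : List Bool) (x y : Bool) :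
    Set.InjOn (insertPair u v x y) {π | IsNCPairingOn (u ++ v) π} := by
  refine Set.InjOn.mono (fun π h => h.1)
    (pushBlocks_injOn (insertMap_strictMono u v x y).injective ?_)
  intro B hB i hi
  rw [Finset.mem_singleton] at hB
  rw [mem_range_insertMap, ← hB]
  exact not_not.2 hi

theorem newBlock_mem_insertPair (u v : List Bool) (x y : Bool)
    (π : Finset (Finset (Fin (u ++ v).length))) :
    newBlock u v x y ∈ insertPair u v x y π :=
  mem_pushBlocks.2 (Or.inr (Finset.mem_singleton_self _))

theorem IsNCPairingOn.insertPair {u v : List Bool} {x y : Bool} (hxy : x ≠ y)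
    {π : Finset (Finset (Fin (u ++ v).length))} (h : IsNCPairingOn (u ++ v) π) :
    IsNCPairingOn (u ++ x :: y :: v) (insertPair u v x y π) := by
  have hmono := insertMap_strictMono u v x y
  refine ⟨h.1.pushBlocks hmono.injective ?_ ?_ ?_, ?_, ?_⟩
  · intro B hB i hi
    rw [Finset.mem_singleton] at hB
    rw [mem_range_insertMap, ← hB]
    exact not_not.2 hi
  · intro B hB
    rw [Finset.mem_singleton] at hB
    rw [hB, newBlock, Finset.card_pair]
    simp
  · intro i hi
    rw [mem_range_insertMap, not_not] at hi
    exact ⟨_, ⟨Finset.mem_singleton_self _, hi⟩, fun B hB => Finset.mem_singleton.1 hB.1⟩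
  · rintro ⟨B, hB, C, hC, i₁, i₂, j₁, j₂, hi₁, hi₂, hj₁, hj₂, h₁, h₂, h₃⟩
    rcases mem_pushBlocks.1 hB with ⟨B, hB', rfl⟩ | hB
    · rcases mem_pushBlocks.1 hC with ⟨C, hC', rfl⟩ | hC
      · obtain ⟨i₁, hi₁', rfl⟩ := Finset.mem_image.1 hi₁
        obtain ⟨i₂, hi₂', rfl⟩ := Finset.mem_image.1 hi₂
        obtain ⟨j₁, hj₁', rfl⟩ := Finset.mem_image.1 hj₁
        obtain ⟨j₂, hj₂', rfl⟩ := Finset.mem_image.1 hj₂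
        rw [hmono.lt_iff_lt] at h₁ h₂ h₃
        exact h.2.1 ⟨B, hB', C, hC', i₁, i₂, j₁, j₂, hi₁', hi₂', hj₁', hj₂', h₁, h₂, h₃⟩
      · rw [Finset.mem_singleton.1 hC, mem_newBlock] at hj₁ hj₂
        rw [Fin.lt_def] at h₁ h₂ h₃
        omega
    · rw [Finset.mem_singleton.1 hB, mem_newBlock] at hi₁ hi₂
      rw [Fin.lt_def] at h₁ h₂ h₃
      omega
  · intro B hB i hi j hj hij
    rcases mem_pushBlocks.1 hB with ⟨B, hB', rfl⟩ | hB
    · obtain ⟨i, hi', rfl⟩ := Finset.mem_image.1 hi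
      obtain ⟨j, hj', rfl⟩ := Finset.mem_image.1 hj
      rw [get_insertMap, get_insertMap]
      exact h.2.2 B hB' i hi' j hj' fun hij' => hij (by rw [hij'])
    · rw [Finset.mem_singleton.1 hB, mem_newBlock] at hi hj
      have hne : (i : ℕ) ≠ j := fun h => hij (Fin.ext h)
      rcases hi with hi | hi <;> rcases hj with hj | hj
      · omega
      · simpa [List.getElem_append, hi, hj] using hxy
      · simpa [List.getElem_append, hi, hj] using hxy.symm
      · omega

/-- Position `q` shares a block with a later position. -/
def PairsRight {N : ℕ} (q : ℕ) (π : Finset (Finset (Fin N))) : Prop :=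
  ∃ B ∈ π, ∃ i ∈ B, ∃ j ∈ B, (i : ℕ) = q ∧ q < (j : ℕ)

/-- The number of non-crossing `w`-pairings in which `q` is paired with a later position. -/
noncomputable def phiRight (w : List Bool) (q : ℕ) : ℕ :=
  Set.ncard {π : Finset (Finset (Fin w.length)) | IsNCPairingOn w π ∧ PairsRight q π}

theorem phi_le_phiRight_insert (u v : List Bool) {x y : Bool} (hxy : x ≠ y) :
    phi (u ++ v) ≤ phiRight (u ++ x :: y :: v) u.length := by
  refine Set.ncard_le_ncard_of_injOn (insertPair u v x y) ?_ (insertPair_injOn u v x y)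
    (Set.toFinite _)
  intro π h
  exact ⟨IsNCPairingOn.insertPair hxy h, _, newBlock_mem_insertPair u v x y π,
    ⟨u.length, by simp⟩, by simp [mem_newBlock], ⟨u.length + 1, by simp⟩,
    by simp [mem_newBlock], rfl, by simp⟩

theorem phiRight_le_phiRight_insert (u v : List Bool) {x y : Bool} (hxy : x ≠ y) {q : ℕ}
    (hq : q < u.length) : phiRight (u ++ v) q ≤ phiRight (u ++ x :: y :: v) q := by
  refine Set.ncard_le_ncard_of_injOn (insertPair u v x y) ?_
    ((insertPair_injOn u v x y).mono fun π h => h.1) (Set.toFinite _)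
  rintro π ⟨h, B, hB, i, hi, j, hj, hiq, hqj⟩
  refine ⟨IsNCPairingOn.insertPair hxy h, _, mem_pushBlocks.2 (Or.inl ⟨B, hB, rfl⟩),
    _, Finset.mem_image_of_mem _ hi, _, Finset.mem_image_of_mem _ hj, ?_, ?_⟩
  · simp [insertMap, hiq, hq]
  · simp only [insertMap]
    split <;> omega

theorem phi_add_phiRight_le (u v : List Bool) {x y : Bool} (hxy : x ≠ y) :
    phi (u ++ v) + phiRight (u ++ x :: y :: v) (u.length + 1) ≤ phi (u ++ x :: y :: v) := by
  have hle : phi (u ++ v) ≤ Set.ncard {π : Finset (Finset (Fin (u ++ x :: y :: v).length)) |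
      IsNCPairingOn (u ++ x :: y :: v) π ∧ newBlock u v x y ∈ π} :=
    Set.ncard_le_ncard_of_injOn (insertPair u v x y)
      (fun π h => ⟨IsNCPairingOn.insertPair hxy h, newBlock_mem_insertPair u v x y π⟩)
      (insertPair_injOn u v x y) (Set.toFinite _)
  refine (Nat.add_le_add_right hle _).trans ?_
  unfold phiRight phi
  rw [← Set.ncard_union_eq ?_ (Set.toFinite _) (Set.toFinite _)]
  · refine Set.ncard_le_ncard ?_ (Set.toFinite _)
    rintro π (h | h) <;> exact h.1
  · rw [Set.disjoint_left]
    rintro π ⟨h, hnew⟩ ⟨-, B, hB, i, hi, j, hj, hiq, hqj⟩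
    have hi' : i ∈ newBlock u v x y := mem_newBlock.2 (Or.inr hiq)
    rw [(h.1.2 i).unique ⟨hB, hi⟩ ⟨hnew, hi'⟩, mem_newBlock] at hj
    omega

theorem phi_le_phi_insert (u v : List Bool) {x y : Bool} (hxy : x ≠ y) :
    phi (u ++ v) ≤ phi (u ++ x :: y :: v) :=
  le_of_add_le_left (phi_add_phiRight_le u v hxy)

theorem phi_le_phiRight_runs (u v : List Bool) {x y : Bool} (hxy : x ≠ y) (b k : ℕ) :
    phi (u ++ (List.replicate b y ++ v)) ≤ phiRight
      (u ++ (List.replicate (k + 1) x ++ (List.replicate (b + (k + 1)) y ++ v))) u.length := by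
  induction k with
  | zero =>
    have := phi_le_phiRight_insert u (List.replicate b y ++ v) hxy
    simpa [List.replicate_succ] using this
  | succ k ih =>
    refine ih.trans ?_
    have := phiRight_le_phiRight_insert (u ++ List.replicate (k + 1) x)
      (List.replicate (b + (k + 1)) y ++ v) hxy (q := u.length) (by simp)
    rw [List.replicate_succ' (n := k + 1), ← Nat.add_assoc b (k + 1),
      List.replicate_succ (n := b + (k + 1))]
    simpa only [List.append_assoc, List.cons_append, List.nil_append] using this

theorem phi_absorb_run (u v : List Bool) {x y : Bool} (hxy : x ≠ y) (a b k : ℕ) :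
    (1 + k) * phi (u ++ (List.replicate (a + k + b) x ++ v)) ≤
      phi (u ++ (List.replicate (a + k) x ++
        (List.replicate k y ++ (List.replicate (b + k) x ++ v)))) := by
  induction k generalizing b with
  | zero => simp [← List.append_assoc (List.replicate a x)]
  | succ k ih =>
    have h₁ := ih (b + 1)
    have h₂ := phi_add_phiRight_le (u ++ List.replicate (a + k) x)
      (List.replicate k y ++ (List.replicate (b + (k + 1)) x ++ v)) hxy
    have h₃ := phi_le_phiRight_runs (u ++ List.replicate (a + (k + 1)) x) v hxy.symm b k
    have e₁ : u ++ (List.replicate (a + (k + 1)) x ++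
        (List.replicate (k + 1) y ++ (List.replicate (b + (k + 1)) x ++ v))) =
        u ++ List.replicate (a + k) x ++
          x :: y :: (List.replicate k y ++ (List.replicate (b + (k + 1)) x ++ v)) := by
      rw [← Nat.add_assoc a, List.replicate_succ' (n := a + k), List.replicate_succ (n := k)]
      simp
    have e₂ : u ++ (List.replicate (a + (k + 1) + b) x ++ v) =
        u ++ List.replicate (a + (k + 1)) x ++ (List.replicate b x ++ v) := by
      simp only [List.append_assoc, ← List.append_assoc (List.replicate _ x),
        List.replicate_append_replicate]
    rw [show a + k + (b + 1) = a + (k + 1) + b by ring, show b + 1 + k = b + (k + 1) by ring] at h₁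
    rw [← e₂, List.append_assoc u (List.replicate (a + (k + 1)) x), e₁] at h₃
    rw [e₁]
    have e₃ : (u ++ List.replicate (a + (k + 1)) x).length =
        (u ++ List.replicate (a + k) x).length + 1 := by simp; ring
    rw [e₃] at h₃
    rw [List.append_assoc u _ (List.replicate k y ++ _)] at h₂
    linarith

theorem phi_cons_le (a : Bool) (w : List Bool) : phi (a :: w) ≤ phi (w ++ [a]) := by
  set f : Fin (a :: w).length → Fin (w ++ [a]).length := fun i =>
    ⟨if (i : ℕ) = 0 then w.length else i - 1, by
      have := i.2
      simp only [List.length_append, List.length_cons, List.length_nil] at this ⊢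
      split <;> omega⟩ with hf
  have hfv : ∀ i, (f i : ℕ) = if (i : ℕ) = 0 then w.length else i - 1 := fun i => rfl
  have hlt : ∀ i : Fin (a :: w).length, (i : ℕ) < w.length + 1 := fun i => i.2
  have hinj : Function.Injective f := by
    intro i j hij
    have h := congrArg Fin.val hij
    have hi := hlt i
    have hj := hlt j
    rw [hfv, hfv] at h
    ext
    split at h <;> split at h <;> omega
  have hsurj : ∀ i, i ∈ Set.range f := by
    intro i
    have hi := i.2
    simp only [List.length_append, List.length_cons, List.length_nil] at hi
    by_cases h : (i : ℕ) = w.length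
    · exact ⟨⟨0, by simp⟩, Fin.ext (by simp [hfv, h])⟩
    · exact ⟨⟨i + 1, by simp only [List.length_cons]; omega⟩, Fin.ext (by simp [hfv])⟩
  have hget : ∀ i, (w ++ [a]).get (f i) = (a :: w).get i := by
    intro i
    rcases i with ⟨_ | i, hi⟩
    · simp [hf]
    · have : i < w.length := by simpa using hi
      simp [hf, this]
  have hE : ∀ B ∈ (∅ : Finset (Finset (Fin (w ++ [a]).length))), ∀ i ∈ B, i ∉ Set.range f := by
    simp
  refine Set.ncard_le_ncard_of_injOn (pushBlocks f ∅) ?_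
    ((pushBlocks_injOn hinj hE).mono fun π h => h.1) (Set.toFinite _)
  intro π h
  refine ⟨h.1.pushBlocks hinj hE (by simp) fun i hi => absurd (hsurj i) hi, ?_, ?_⟩
  · rintro ⟨B, hB, C, hC, i₁, i₂, j₁, j₂, hi₁, hi₂, hj₁, hj₂, h₁, h₂, h₃⟩
    obtain ⟨B, hB', rfl⟩ := (mem_pushBlocks.1 hB).resolve_right (by simp)
    obtain ⟨C, hC', rfl⟩ := (mem_pushBlocks.1 hC).resolve_right (by simp)
    obtain ⟨i₁, hi₁', rfl⟩ := Finset.mem_image.1 hi₁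
    obtain ⟨i₂, hi₂', rfl⟩ := Finset.mem_image.1 hi₂
    obtain ⟨j₁, hj₁', rfl⟩ := Finset.mem_image.1 hj₁
    obtain ⟨j₂, hj₂', rfl⟩ := Finset.mem_image.1 hj₂
    rw [Fin.lt_def, hfv, hfv] at h₁ h₂ h₃
    have := hlt i₁
    have := hlt i₂
    have := hlt j₁
    have := hlt j₂
    by_cases h0 : (j₂ : ℕ) = 0
    · refine h.2.1 ⟨C, hC', B, hB', j₂, j₁, i₁, i₂, hj₂', hj₁', hi₁', hi₂', ?_, ?_, ?_⟩ <;>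
        rw [Fin.lt_def] <;> split_ifs at h₁ h₂ h₃ <;> omega
    · refine h.2.1 ⟨B, hB', C, hC', i₁, i₂, j₁, j₂, hi₁', hi₂', hj₁', hj₂', ?_, ?_, ?_⟩ <;>
        rw [Fin.lt_def] <;> split_ifs at h₁ h₂ h₃ <;> omega
  · intro B hB i hi j hj hij
    obtain ⟨B, hB', rfl⟩ := (mem_pushBlocks.1 hB).resolve_right (by simp)
    obtain ⟨i, hi', rfl⟩ := Finset.mem_image.1 hi
    obtain ⟨j, hj', rfl⟩ := Finset.mem_image.1 hj
    rw [hget, hget]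
    exact h.2.2 B hB' i hi' j hj' fun hij' => hij (by rw [hij'])

theorem phi_append_comm_le (u v : List Bool) : phi (u ++ v) ≤ phi (v ++ u) := by
  induction u generalizing v with
  | nil => simp
  | cons a u ih =>
    calc phi (a :: u ++ v) ≤ phi (u ++ v ++ [a]) := phi_cons_le a (u ++ v)
      _ = phi (u ++ (v ++ [a])) := by rw [List.append_assoc]
      _ ≤ phi (v ++ [a] ++ u) := ih _
      _ = phi (v ++ a :: u) := by simp

theorem one_le_phi_replicate (a : ℕ) :
    1 ≤ phi (List.replicate a true ++ List.replicate a false) := by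
  induction a with
  | zero =>
    rw [Nat.one_le_iff_ne_zero]
    refine Set.ncard_ne_zero_of_mem (a := ∅) ?_ (Set.toFinite _)
    refine ⟨⟨by simp, fun i => absurd i.2 (by simp)⟩, ?_, by simp⟩
    rintro ⟨B, hB, -⟩
    simp at hB
  | succ a ih =>
    refine ih.trans ?_
    rw [List.replicate_succ' (a := true), List.replicate_succ (a := false)]
    simpa using phi_le_phi_insert (List.replicate a true) (List.replicate a false)
      Bool.false_ne_true.symm

/-- The word `1^a 0^b ⋯` with one pair of runs for each entry `(a, b)` of `L`. -/
def runsWord (L : List (ℕ × ℕ)) : List Bool :=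
  L.flatMap fun p => List.replicate p.1 true ++ List.replicate p.2 false

theorem runsWord_append (L L' : List (ℕ × ℕ)) :
    runsWord (L ++ L') = runsWord L ++ runsWord L' :=
  List.flatMap_append

theorem phi_runsWord_rotate_le (L L' : List (ℕ × ℕ)) :
    phi (runsWord (L ++ L')) ≤ phi (runsWord (L' ++ L)) := by
  rw [runsWord_append, runsWord_append]
  exact phi_append_comm_le _ _

theorem runsWord_cons (p : ℕ × ℕ) (L : List (ℕ × ℕ)) :
    runsWord (p :: L) =
      List.replicate p.1 true ++ (List.replicate p.2 false ++ runsWord L) := by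
  simp [runsWord]

theorem pow_le_phi_runsWord (i : ℕ) (L : List (ℕ × ℕ)) (hL : L ≠ [])
    (hle : ∀ p ∈ L, i ≤ p.1 ∧ i ≤ p.2)
    (hbal : (L.map Prod.fst).sum = (L.map Prod.snd).sum) :
    (1 + i) ^ (L.length - 1) ≤ phi (runsWord L) := by
  induction hlen : L.length using Nat.strong_induction_on generalizing L with
  | _ len ih =>
  obtain ⟨p, hp, hmin⟩ := Finset.exists_min_image L.toFinset (fun p => min p.1 p.2)
    (by simpa using hL)
  simp only [List.mem_toFinset] at hp hmin
  obtain ⟨s, t, rfl⟩ := List.append_of_mem hp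
  refine le_trans ?_ (phi_runsWord_rotate_le (p :: t) s)
  obtain ⟨a, b⟩ := p
  have step : ∀ (k : ℕ) (M : List (ℕ × ℕ)) (W : ℕ), M ≠ [] → M.length + 1 = len →
      (∀ q ∈ M, i ≤ q.1 ∧ i ≤ q.2) → (M.map Prod.fst).sum = (M.map Prod.snd).sum →
      i ≤ k → (1 + k) * phi (runsWord M) ≤ W → (1 + i) ^ (len - 1) ≤ W := by
    intro k M W hM hMlen hMle hMbal hk hW
    have h := ih M.length (by omega) M hM hMle hMbal rfl
    obtain ⟨l, hl⟩ : ∃ l, M.length = l + 1 :=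
      ⟨M.length - 1, by have := List.length_pos_iff.2 hM; omega⟩
    refine le_trans ?_ hW
    rw [hl] at h
    rw [← hMlen, hl, Nat.add_sub_cancel, pow_succ, mul_comm]
    exact Nat.mul_le_mul (by omega) h
  rw [List.cons_append]
  have hmem : ∀ q ∈ t ++ s, q ∈ s ++ (a, b) :: t := by
    intro q hq
    simp only [List.mem_append, List.mem_cons] at hq ⊢
    tauto
  have hN : (t ++ s).length + 1 = len := by
    rw [← hlen]
    simp only [List.length_append, List.length_cons]
    omega
  have hNbal : a + ((t ++ s).map Prod.fst).sum = b + ((t ++ s).map Prod.snd).sum := by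
    simp only [List.map_append, List.map_cons, List.sum_append, List.sum_cons] at hbal ⊢
    omega
  have hab := hle (a, b) hp
  have hNle : ∀ q ∈ t ++ s, i ≤ q.1 ∧ i ≤ q.2 := fun q hq => hle q (hmem q hq)
  have hNmin : ∀ q ∈ t ++ s, min a b ≤ q.1 ∧ min a b ≤ q.2 := fun q hq =>
    le_min_iff.1 (hmin q (hmem q hq))
  generalize t ++ s = N at hN hNbal hNle hNmin
  clear hle hbal hlen hmin hmem hp hL
  rcases N.eq_nil_or_concat' with rfl | ⟨M, ⟨c, d⟩, rfl⟩
  · obtain rfl : a = b := by simpa using hNbal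
    rw [← hN]
    simpa [runsWord] using one_le_phi_replicate a
  rcases le_total a b with hba | hba
  · rw [min_eq_left hba] at hNmin
    refine le_trans ?_ (phi_runsWord_rotate_le [(c, d)] ((a, b) :: M))
    obtain ⟨β, rfl⟩ := Nat.exists_eq_add_of_le' hba
    obtain ⟨α, rfl⟩ := Nat.exists_eq_add_of_le' (hNmin (c, d) (by simp)).2
    have hcd := hNle (c, α + a) (by simp)
    refine step a ((c, α + a + β) :: M) _ (by simp) (by simpa using hN) ?_ ?_ hab.1 ?_
    · intro q hq
      rcases List.mem_cons.1 hq with rfl | hq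
      · exact ⟨hcd.1, by have := hcd.2; simp only at this ⊢; omega⟩
      · exact hNle q (by simp [hq])
    · simp only [List.map_append, List.map_cons, List.sum_append, List.sum_cons,
        List.map_nil, List.sum_nil] at hNbal ⊢
      omega
    · simpa [runsWord_cons] using phi_absorb_run (List.replicate c true) (runsWord M)
        Bool.false_ne_true α β a
  · rw [min_eq_right hba] at hNmin
    obtain ⟨⟨c, d⟩, M, hM⟩ := List.exists_cons_of_ne_nil (List.append_ne_nil_of_right_ne_nil M
      (List.cons_ne_nil (c, d) []))
    rw [hM] at hN hNbal hNle hNmin ⊢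
    obtain ⟨α, rfl⟩ := Nat.exists_eq_add_of_le' hba
    obtain ⟨β, rfl⟩ := Nat.exists_eq_add_of_le' (hNmin (c, d) (by simp)).1
    have hcd := hNle (β + b, d) (by simp)
    refine step b ((α + b + β, d) :: M) _ (by simp) (by simpa using hN) ?_ ?_ hab.2 ?_
    · intro q hq
      rcases List.mem_cons.1 hq with rfl | hq
      · exact ⟨by have := hcd.1; simp only at this ⊢; omega, hcd.2⟩
      · exact hNle q (by simp [hq])
    · simp only [List.map_cons, List.sum_cons] at hNbal ⊢
      omega
    · simpa [runsWord_cons] using phi_absorb_run [] (List.replicate d false ++ runsWord M)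
        Bool.false_ne_true.symm α β b

theorem runsF_eq_runsWord {r : ℕ} (n m : Fin r → ℕ) :
    runsF n m = runsWord (List.ofFn fun j => (n j, m j)) := by
  rw [List.ofFn_eq_map, runsWord, List.flatMap_map, runsF]

/-- lower bound. If `i` is the minimum of all block sizes of the
balanced word `1^{n₁}0^{m₁}⋯1^{n_r}0^{m_r}`, then `φ(S) ≥ (1+i)^{r-1}`. -/
theorem stmt7 (r : ℕ) (hr : 1 ≤ r) (n m : Fin r → ℕ)
    (hn : ∀ j, 1 ≤ n j) (hm : ∀ j, 1 ≤ m j)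
    (hbal : ∑ j, n j = ∑ j, m j)
    (i : ℕ) (hle : ∀ j, i ≤ n j ∧ i ≤ m j) (hatt : ∃ j, i = n j ∨ i = m j) :
    (1 + i) ^ (r - 1) ≤ phi (runsF n m) := by
  rw [runsF_eq_runsWord]
  have h := pow_le_phi_runsWord i (List.ofFn fun j => (n j, m j))
    (by rw [Ne, List.ofFn_eq_nil_iff]; omega)
    (by
      intro p hp
      obtain ⟨j, rfl⟩ := (List.mem_ofFn' _ _).1 hp
      exact hle j)
    (by simpa [List.map_ofFn, List.sum_ofFn, Function.comp_def] using hbal)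
  rwa [List.length_ofFn] at h
end
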